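/- arXiv:2510.07512 — 4 statements merged into one kernel-verified Lean document; each statement's English description precedes it below -/
import Mathlib

section
/- Let ℰ be a quantum channel from states on ℂ^{2^k} to states on ℂ^{m}. If the coherent information on the maximally mixed input satisfies I_c = −k, then for every quantum channel 𝒟 from states on ℂ^{m} to states on ℂ^{2^k} and every pair of unit vectors |ψ₁⟩, |ψ₂⟩ ∈ ℂ^{2^k}, one has 𝒟(ℰ(|ψ₁⟩⟨ψ₁|)) = 𝒟(ℰ(|ψ₂⟩⟨ψ₂|)); i.e., no logical information can be transmitted. -/
open Matrix

noncomputable section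

/-- Partial trace over the first (reference) tensor factor. -/
def ptraceFirst {R B : Type*} [Fintype R] (M : Matrix (R × B) (R × B) ℂ) : Matrix B B ℂ :=
  Matrix.of fun b b' => ∑ r, M (r, b) (r, b')

/-- Density matrix of the maximally entangled state `|Φ⟩ = (card A)^{-1/2} ∑ᵢ |i⟩⊗|i⟩`. -/
def maxEnt (A : Type*) [Fintype A] [DecidableEq A] : Matrix (A × A) (A × A) ℂ :=
  Matrix.of fun x y => if x.1 = x.2 ∧ y.1 = y.2 then ((Fintype.card A : ℂ))⁻¹ else 0

/-- The map `Id ⊗ ℰ` acting on operators on `R ⊗ A`, defined entrywise. -/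
def idTensor {R A B : Type*} (E : Matrix A A ℂ → Matrix B B ℂ)
    (M : Matrix (R × A) (R × A) ℂ) : Matrix (R × B) (R × B) ℂ :=
  Matrix.of fun x y => E (Matrix.of fun a a' => M (x.1, a) (y.1, a')) x.2 y.2

/-- Von Neumann entropy in bits, `S(ρ) = -Tr[ρ log₂ ρ]`, via the eigenvalues of `ρ`
(with the convention `0 log 0 = 0`). -/
def vN {ι : Type*} [Fintype ι] [DecidableEq ι] (ρ : Matrix ι ι ℂ) : ℝ :=
  if h : ρ.IsHermitian then -∑ i, (h.eigenvalues i) * Real.logb 2 (h.eigenvalues i) else 0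

/-- Coherent information of a channel on the maximally mixed input:
`I_c = S(ρ_B) − S(ρ_RB)` where `ρ_RB = (Id ⊗ ℰ)(|Φ⟩⟨Φ|)`. -/
def cohInfo {A B : Type*} [Fintype A] [DecidableEq A] [Fintype B] [DecidableEq B]
    (E : Matrix A A ℂ → Matrix B B ℂ) : ℝ :=
  vN (ptraceFirst (idTensor (R := A) E (maxEnt A))) - vN (idTensor (R := A) E (maxEnt A))

/-- A quantum channel: a map admitting a Kraus representation `{K_j}` with `∑ⱼ Kⱼ†Kⱼ = I`
and `Φ(M) = ∑ⱼ Kⱼ M Kⱼ†`. -/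
def IsQChannel {A B : Type*} [Fintype A] [DecidableEq A] [Fintype B]
    (Φ : Matrix A A ℂ → Matrix B B ℂ) : Prop :=
  ∃ (s : ℕ) (K : Fin s → Matrix B A ℂ),
    (∑ j, (K j)ᴴ * K j) = 1 ∧ ∀ M, Φ M = ∑ j, K j * M * (K j)ᴴ

/-- The rank-one projector `|ψ⟩⟨ψ|`. -/
def outer {A : Type*} (ψ : A → ℂ) : Matrix A A ℂ := Matrix.vecMulVec ψ (star ψ)

open Real (negMulLog)
open scoped Kronecker ComplexOrder

section Entropy

variable {ι : Type*} [Fintype ι]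

/-- The uniform distribution is the unique maximizer of entropy among nonnegative vectors with a
given sum. -/
lemma eq_div_card_of_entropy_le [Nonempty ι] {a : ι → ℝ} (ha : ∀ i, 0 ≤ a i) :
    ∑ i, negMulLog (a i) ≤
        negMulLog (∑ i, a i) + (∑ i, a i) * Real.log (Fintype.card ι) ∧
      (∑ i, negMulLog (a i) =
          negMulLog (∑ i, a i) + (∑ i, a i) * Real.log (Fintype.card ι) →
        ∀ i, a i = (Fintype.card ι : ℝ)⁻¹ * ∑ i, a i) := by
  have hd : (Fintype.card ι : ℝ) ≠ 0 := by exact_mod_cast Fintype.card_ne_zero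
  have hw : ∀ i ∈ (Finset.univ : Finset ι), 0 ≤ (Fintype.card ι : ℝ)⁻¹ := fun _ _ => by positivity
  have hw₁ : ∑ _i : ι, (Fintype.card ι : ℝ)⁻¹ = 1 := by simp [hd]
  have hmem : ∀ i ∈ Finset.univ, a i ∈ Set.Ici (0 : ℝ) := fun i _ => ha i
  have hval : negMulLog (∑ i, (Fintype.card ι : ℝ)⁻¹ • a i) = (Fintype.card ι : ℝ)⁻¹ *
      (negMulLog (∑ i, a i) + (∑ i, a i) * Real.log (Fintype.card ι)) := by
    rw [← Finset.smul_sum, smul_eq_mul, Real.negMulLog_mul, negMulLog.eq_1 (_⁻¹), Real.log_inv]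
    ring
  constructor
  · have h := Real.concaveOn_negMulLog.le_map_sum hw hw₁ hmem
    rw [hval, ← Finset.smul_sum, smul_eq_mul] at h
    exact le_of_mul_le_mul_left h (by positivity)
  · intro h i
    have := (Real.strictConcaveOn_negMulLog.map_sum_eq_iff' hw hw₁ hmem).mp
      (by rw [hval, ← h, ← Finset.smul_sum, smul_eq_mul]) i (Finset.mem_univ i) (inv_ne_zero hd)
    rw [this, ← Finset.smul_sum, smul_eq_mul]

variable [DecidableEq ι]

lemma vN_eq_sum_negMulLog {ρ : Matrix ι ι ℂ} (h : ρ.IsHermitian) :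
    vN ρ = (∑ i, negMulLog (h.eigenvalues i)) / Real.log 2 := by
  rw [vN, dif_pos h, ← Finset.sum_neg_distrib, Finset.sum_div]
  refine Finset.sum_congr rfl fun i _ => ?_
  rw [negMulLog, Real.logb]
  ring

lemma sum_normSq_row_of_unitary {W : Matrix ι ι ℂ} (hW : W * Wᴴ = 1) (j : ι) :
    ∑ i, Complex.normSq (W j i) = 1 := by
  have h := congrFun (congrFun hW j) j
  rw [mul_apply, one_apply_eq] at h
  have h' : ((∑ i, Complex.normSq (W j i) : ℝ) : ℂ) = 1 := by
    rw [← h]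
    push_cast
    exact Finset.sum_congr rfl fun i _ => (Complex.mul_conj _).symm
  exact_mod_cast h'

lemma sum_normSq_col_of_unitary {W : Matrix ι ι ℂ} (hW : Wᴴ * W = 1) (i : ι) :
    ∑ j, Complex.normSq (W j i) = 1 := by
  have h := sum_normSq_row_of_unitary (W := Wᴴ) (by simpa using hW) i
  simpa [conjTranspose_apply, Complex.normSq_conj] using h

lemma conj_diagonal_apply_self (W : Matrix ι ι ℂ) (p : ι → ℝ) (j : ι) :
    (W * diagonal (fun i => (p i : ℂ)) * Wᴴ) j j =
      ((∑ i, Complex.normSq (W j i) * p i : ℝ) : ℂ) := by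
  rw [mul_apply]
  push_cast
  refine Finset.sum_congr rfl fun i _ => ?_
  rw [mul_diagonal, conjTranspose_apply, ← Complex.mul_conj, Complex.star_def]
  ring

/-- Dephasing increases entropy, and preserves it only for a matrix that is already diagonal. -/
lemma conj_diagonal_eq_diagonal_of_entropy_le {W : Matrix ι ι ℂ} (hW : W * Wᴴ = 1)
    {p : ι → ℝ} (hp : ∀ i, 0 ≤ p i) {a : ι → ℝ}
    (ha : ∀ j, (W * diagonal (fun i => (p i : ℂ)) * Wᴴ) j j = (a j : ℂ)) :
    ∑ i, negMulLog (p i) ≤ ∑ j, negMulLog (a j) ∧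
      (∑ j, negMulLog (a j) ≤ ∑ i, negMulLog (p i) →
        W * diagonal (fun i => (p i : ℂ)) * Wᴴ = diagonal fun j => (a j : ℂ)) := by
  have hW' : Wᴴ * W = 1 := mul_eq_one_comm.mp hW
  have ha' : ∀ j, a j = ∑ i, Complex.normSq (W j i) • p i := fun j => by
    have h := ha j
    rw [conj_diagonal_apply_self] at h
    exact_mod_cast h.symm
  have hnn : ∀ j, ∀ i ∈ Finset.univ, 0 ≤ Complex.normSq (W j i) :=
    fun j i _ => Complex.normSq_nonneg _
  have hmem : ∀ i ∈ Finset.univ, p i ∈ Set.Ici (0 : ℝ) := fun i _ => hp i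
  have hjensen : ∀ j, ∑ i, Complex.normSq (W j i) • negMulLog (p i) ≤ negMulLog (a j) := fun j => by
    rw [ha']
    exact Real.concaveOn_negMulLog.le_map_sum (hnn j) (sum_normSq_row_of_unitary hW j) hmem
  have hsum : ∑ j, ∑ i, Complex.normSq (W j i) • negMulLog (p i) = ∑ i, negMulLog (p i) := by
    rw [Finset.sum_comm]
    refine Finset.sum_congr rfl fun i _ => ?_
    rw [← Finset.sum_smul, sum_normSq_col_of_unitary hW', one_smul]
  refine ⟨hsum ▸ Finset.sum_le_sum fun j _ => hjensen j, fun hle => ?_⟩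
  have heq : ∀ j ∈ Finset.univ,
      ∑ i, Complex.normSq (W j i) • negMulLog (p i) = negMulLog (a j) :=
    (Finset.sum_eq_sum_iff_of_le fun j _ => hjensen j).mp
      (le_antisymm (Finset.sum_le_sum fun j _ => hjensen j) (hsum ▸ hle))
  have hcomm : W * diagonal (fun i => (p i : ℂ)) = diagonal (fun j => (a j : ℂ)) * W := by
    ext j i
    rw [mul_diagonal, diagonal_mul]
    by_cases hji : W j i = 0
    · simp [hji]
    · have h := (Real.strictConcaveOn_negMulLog.map_sum_eq_iff' (hnn j)
        (sum_normSq_row_of_unitary hW j) hmem).mp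
          (by rw [← ha' j]; exact (heq j (Finset.mem_univ j)).symm) i (Finset.mem_univ i)
          (by simpa using hji)
      rw [h, ← ha' j, mul_comm]
  rw [hcomm, Matrix.mul_assoc, hW, Matrix.mul_one]

end Entropy

section PartialTrace

variable {R B : Type*} [Fintype R]

lemma ptraceFirst_posSemidef {M : Matrix (R × B) (R × B) ℂ} (hM : M.PosSemidef) :
    (ptraceFirst M).PosSemidef := by
  have h : ptraceFirst M = ∑ r, M.submatrix (Prod.mk r) (Prod.mk r) := by
    ext b b'
    simp [ptraceFirst, Matrix.sum_apply]
  rw [h]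
  exact posSemidef_sum _ fun r _ => hM.submatrix _

variable [Fintype B]

lemma trace_ptraceFirst (M : Matrix (R × B) (R × B) ℂ) : (ptraceFirst M).trace = M.trace := by
  simp only [trace, diag, ptraceFirst, of_apply]
  rw [Finset.sum_comm, Fintype.sum_prod_type]

variable [DecidableEq R]

lemma one_kronecker_mul_apply (V : Matrix B B ℂ) (M : Matrix (R × B) (R × B) ℂ)
    (r : R) (b : B) (y : R × B) :
    (((1 : Matrix R R ℂ) ⊗ₖ V) * M) (r, b) y = ∑ c, V b c * M (r, c) y := by
  simp [mul_apply, Fintype.sum_prod_type, kroneckerMap_apply, one_apply]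

lemma mul_one_kronecker_apply (V : Matrix B B ℂ) (M : Matrix (R × B) (R × B) ℂ)
    (x : R × B) (r : R) (b : B) :
    (M * ((1 : Matrix R R ℂ) ⊗ₖ V)) x (r, b) = ∑ c, M x (r, c) * V c b := by
  simp [mul_apply, Fintype.sum_prod_type, kroneckerMap_apply, one_apply]

lemma ptraceFirst_one_kronecker_conj (U V : Matrix B B ℂ) (M : Matrix (R × B) (R × B) ℂ) :
    ptraceFirst ((1 : Matrix R R ℂ) ⊗ₖ U * M * ((1 : Matrix R R ℂ) ⊗ₖ V)) =
      U * ptraceFirst M * V := by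
  ext b b'
  simp only [ptraceFirst, of_apply, mul_one_kronecker_apply, one_kronecker_mul_apply]
  simp only [mul_apply, of_apply, Finset.mul_sum, Finset.sum_mul]
  rw [Finset.sum_comm]
  refine Finset.sum_congr rfl fun c _ => ?_
  rw [Finset.sum_comm]

variable [DecidableEq B]

/-- If the entropy of a state exceeds that of its second marginal by the maximal amount
`log (card R)`, the state is the product of the maximally mixed state and this marginal. -/
lemma eq_one_kronecker_of_entropy_eq [Nonempty R] {ρ : Matrix (R × B) (R × B) ℂ}
    (hρ : ρ.PosSemidef) (hσ : (ptraceFirst ρ).IsHermitian) (htr : ρ.trace = 1)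
    (hS : ∑ x, negMulLog (hρ.1.eigenvalues x) =
      ∑ b, negMulLog (hσ.eigenvalues b) + Real.log (Fintype.card R)) :
    ρ = (1 : Matrix R R ℂ) ⊗ₖ ((Fintype.card R : ℂ)⁻¹ • ptraceFirst ρ) := by
  set q := hσ.eigenvalues
  set p := hρ.1.eigenvalues
  set U : Matrix B B ℂ := hσ.eigenvectorUnitary.1
  set X : Matrix (R × B) (R × B) ℂ := hρ.1.eigenvectorUnitary.1
  have hUU : Uᴴ * U = 1 := Unitary.coe_star_mul_self hσ.eigenvectorUnitary
  have hUU' : U * Uᴴ = 1 := Unitary.coe_mul_star_self hσ.eigenvectorUnitary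
  have hXX : X * Xᴴ = 1 := Unitary.coe_mul_star_self hρ.1.eigenvectorUnitary
  have hσU : ptraceFirst ρ = U * diagonal (fun b => (q b : ℂ)) * Uᴴ := hσ.spectral_theorem
  have hρX : ρ = X * diagonal (fun x => (p x : ℂ)) * Xᴴ := hρ.1.spectral_theorem
  set V : Matrix (R × B) (R × B) ℂ := (1 : Matrix R R ℂ) ⊗ₖ U with hV
  have hVH : Vᴴ = (1 : Matrix R R ℂ) ⊗ₖ Uᴴ := by
    rw [hV, conjTranspose_kronecker, conjTranspose_one]
  have hVV : Vᴴ * V = 1 := by rw [hVH, hV, ← mul_kronecker_mul, hUU, Matrix.one_mul,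
    one_kronecker_one]
  have hVV' : V * Vᴴ = 1 := mul_eq_one_comm.mp hVV
  have hN : (Vᴴ * X) * diagonal (fun x => (p x : ℂ)) * (Vᴴ * X)ᴴ = Vᴴ * ρ * V := by
    rw [hρX, conjTranspose_mul, conjTranspose_conjTranspose]
    simp only [Matrix.mul_assoc]
  have hNpos : (Vᴴ * ρ * V).PosSemidef := hρ.conjTranspose_mul_mul_same V
  have hpt : ptraceFirst (Vᴴ * ρ * V) = diagonal fun b => (q b : ℂ) := by
    rw [hVH, hV, ptraceFirst_one_kronecker_conj, hσU]
    simp only [Matrix.mul_assoc, hUU, Matrix.mul_one]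
    rw [← Matrix.mul_assoc, hUU, Matrix.one_mul]
  set a : R × B → ℝ := fun x => ((Vᴴ * ρ * V) x x).re
  have hdiag : ∀ x, (Vᴴ * ρ * V) x x = (a x : ℂ) := fun x => (hNpos.1.coe_re_apply_self x).symm
  have ha₀ : ∀ x, 0 ≤ a x := fun x => (Complex.nonneg_iff.mp hNpos.diag_nonneg).1
  have hmarg : ∀ b, ∑ r, a (r, b) = q b := fun b => by
    have h := congrFun (congrFun hpt b) b
    simp only [ptraceFirst, of_apply, hdiag, diagonal_apply_eq] at h
    exact_mod_cast h
  have hq₁ : ∑ b, q b = 1 := by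
    have h := hσ.trace_eq_sum_eigenvalues
    rw [trace_ptraceFirst, htr] at h
    exact Complex.ofReal_injective (by simpa using h.symm)
  obtain ⟨hle, heq⟩ := conj_diagonal_eq_diagonal_of_entropy_le (W := Vᴴ * X) (p := p) (a := a)
    (by rw [conjTranspose_mul, conjTranspose_conjTranspose, Matrix.mul_assoc, ← Matrix.mul_assoc X,
          hXX, Matrix.one_mul, hVV])
    hρ.eigenvalues_nonneg (fun x => by rw [hN, hdiag])
  have hmax : ∀ b, ∑ r, negMulLog (a (r, b)) ≤
      negMulLog (q b) + q b * Real.log (Fintype.card R) := fun b => by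
    have h := (eq_div_card_of_entropy_le (a := fun r => a (r, b)) fun r => ha₀ _).1
    rwa [hmarg] at h
  have htot : ∑ b, (negMulLog (q b) + q b * Real.log (Fintype.card R)) =
      ∑ x, negMulLog (p x) := by
    rw [hS, Finset.sum_add_distrib, ← Finset.sum_mul, hq₁, one_mul]
  have hsplit : ∑ x, negMulLog (a x) = ∑ b, ∑ r, negMulLog (a (r, b)) :=
    Fintype.sum_prod_type_right _
  have hup : ∑ x, negMulLog (a x) ≤ ∑ x, negMulLog (p x) := by
    rw [hsplit, ← htot]
    exact Finset.sum_le_sum fun b _ => hmax b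
  have hmaxeq := (Finset.sum_eq_sum_iff_of_le fun b _ => hmax b).mp
    (by rw [← hsplit, htot]; exact le_antisymm hup hle)
  have haq : ∀ r b, a (r, b) = (Fintype.card R : ℝ)⁻¹ * q b := fun r b => by
    have h := (eq_div_card_of_entropy_le (a := fun r => a (r, b)) fun r => ha₀ _).2
    rw [hmarg] at h
    exact h (hmaxeq b (Finset.mem_univ b)) r
  have hfin : Vᴴ * ρ * V = (1 : Matrix R R ℂ) ⊗ₖ
      ((Fintype.card R : ℂ)⁻¹ • diagonal fun b => (q b : ℂ)) := by
    rw [← hN, heq hup, ← diagonal_smul, ← diagonal_one, diagonal_kronecker_diagonal]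
    congr 1
    ext ⟨r, b⟩
    simp [haq]
  calc ρ = V * (Vᴴ * ρ * V) * Vᴴ := by
        simp only [Matrix.mul_assoc, hVV', Matrix.mul_one]
        rw [← Matrix.mul_assoc, hVV', Matrix.one_mul]
    _ = _ := by
        rw [hfin, hVH, hV, ← mul_kronecker_mul, ← mul_kronecker_mul, hσU]
        simp

end PartialTrace

section Channel

variable {A B : Type*} [Fintype A] [DecidableEq A] [Fintype B]

lemma IsQChannel.trace_apply {Φ : Matrix A A ℂ → Matrix B B ℂ} (hΦ : IsQChannel Φ)
    (M : Matrix A A ℂ) : (Φ M).trace = M.trace := by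
  obtain ⟨s, K, hK, h⟩ := hΦ
  rw [h, trace_sum]
  simp only [fun j => trace_mul_cycle (K j) M (K j)ᴴ]
  rw [← trace_sum, ← Finset.sum_mul, hK, Matrix.one_mul]

lemma of_maxEnt (r r' : A) :
    (of fun a a' => maxEnt A (r, a) (r', a')) = (Fintype.card A : ℂ)⁻¹ • single r r' (1 : ℂ) := by
  ext a a'
  simp [maxEnt, single_apply]

lemma IsQChannel.idTensor_maxEnt_posSemidef {Φ : Matrix A A ℂ → Matrix B B ℂ}
    (hΦ : IsQChannel Φ) : (idTensor (R := A) Φ (maxEnt A)).PosSemidef := by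
  obtain ⟨s, K, -, h⟩ := hΦ
  have hsum : idTensor (R := A) Φ (maxEnt A) = (Fintype.card A : ℂ)⁻¹ •
      ∑ j, vecMulVec (fun x : A × B => K j x.2 x.1) (star fun x : A × B => K j x.2 x.1) := by
    ext ⟨r, b⟩ ⟨r', b'⟩
    simp [idTensor, of_maxEnt, h, Matrix.sum_apply, vecMulVec_apply, mul_apply, single_apply,
      Finset.mul_sum, ite_and]
    exact Finset.sum_congr rfl fun j _ => by ring
  rw [hsum]
  refine (posSemidef_sum _ fun j _ => posSemidef_vecMulVec_self_star _).smul ?_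
  positivity

lemma IsQChannel.trace_idTensor_maxEnt [Nonempty A] {Φ : Matrix A A ℂ → Matrix B B ℂ}
    (hΦ : IsQChannel Φ) : (idTensor (R := A) Φ (maxEnt A)).trace = 1 := by
  have h : (idTensor (R := A) Φ (maxEnt A)).trace =
      ∑ r, (Φ (of fun a a' => maxEnt A (r, a) (r, a'))).trace := by
    simp [trace, idTensor, Fintype.sum_prod_type]
  rw [h]
  simp [hΦ.trace_apply, of_maxEnt]

/-- A channel whose Choi state is a product with the maximally mixed state is constant on
matrices of equal trace. -/
lemma IsQChannel.apply_eq_trace_smul [Nonempty A] {Φ : Matrix A A ℂ → Matrix B B ℂ}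
    (hΦ : IsQChannel Φ) {σ : Matrix B B ℂ}
    (hσ : idTensor (R := A) Φ (maxEnt A) = (1 : Matrix A A ℂ) ⊗ₖ ((Fintype.card A : ℂ)⁻¹ • σ))
    (M : Matrix A A ℂ) : Φ M = M.trace • σ := by
  have hd : (Fintype.card A : ℂ) ≠ 0 := by exact_mod_cast Fintype.card_ne_zero
  obtain ⟨L, hL⟩ : ∃ L : Matrix A A ℂ →ₗ[ℂ] Matrix B B ℂ, ∀ M, L M = Φ M := by
    obtain ⟨s, K, -, h⟩ := hΦ
    refine ⟨⟨⟨Φ, fun M N => ?_⟩, fun c M => ?_⟩, fun M => rfl⟩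
    · simp [h, Matrix.mul_add, Matrix.add_mul, Finset.sum_add_distrib]
    · simp [h, Finset.smul_sum]
  have hsingle : ∀ r r', L (single r r' 1) = (1 : Matrix A A ℂ) r r' • σ := fun r r' => by
    ext b b'
    have h := congrFun (congrFun hσ (r, b)) (r', b')
    simp only [idTensor, of_maxEnt, of_apply, ← hL, map_smul, kroneckerMap_apply, Matrix.smul_apply,
      smul_eq_mul] at h ⊢
    rw [mul_left_comm] at h
    exact mul_left_cancel₀ (inv_ne_zero hd) h
  rw [← hL]
  conv_lhs => rw [matrix_eq_sum_single M]
  have hM : ∀ r r', single r r' (M r r') = M r r' • single r r' (1 : ℂ) := fun r r' => by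
    rw [smul_single, smul_eq_mul, mul_one]
  simp_rw [map_sum, hM, map_smul, hsingle, one_apply, trace, diag, Finset.sum_smul]
  simp

end Channel

lemma trace_outer {A : Type*} [Fintype A] (ψ : A → ℂ) : (outer ψ).trace = star ψ ⬝ᵥ ψ := by
  rw [outer, trace_vecMulVec, dotProduct_comm]

/-- If the coherent information of `ℰ` on the maximally mixed input equals
`−k`, then for every decoding channel `𝒟` and all unit vectors `ψ₁, ψ₂`,
`𝒟(ℰ(|ψ₁⟩⟨ψ₁|)) = 𝒟(ℰ(|ψ₂⟩⟨ψ₂|))`: no logical information can be transmitted. -/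
theorem no_info_of_min_coherent_info
    (k m : ℕ)
    (E : Matrix (Fin (2 ^ k)) (Fin (2 ^ k)) ℂ → Matrix (Fin m) (Fin m) ℂ)
    (hE : IsQChannel E)
    (hIc : cohInfo E = -(k : ℝ)) :
    ∀ D : Matrix (Fin m) (Fin m) ℂ → Matrix (Fin (2 ^ k)) (Fin (2 ^ k)) ℂ,
      IsQChannel D →
        ∀ ψ₁ ψ₂ : Fin (2 ^ k) → ℂ, star ψ₁ ⬝ᵥ ψ₁ = 1 → star ψ₂ ⬝ᵥ ψ₂ = 1 →
          D (E (outer ψ₁)) = D (E (outer ψ₂)) := by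
  intro D _ ψ₁ ψ₂ h₁ h₂
  have hρ := hE.idTensor_maxEnt_posSemidef
  have hσ := (ptraceFirst_posSemidef hρ).1
  have hlog : Real.log 2 ≠ 0 := (Real.log_pos one_lt_two).ne'
  have hS : ∑ x, negMulLog (hρ.1.eigenvalues x) = ∑ b, negMulLog (hσ.eigenvalues b) +
      Real.log (Fintype.card (Fin (2 ^ k))) := by
    rw [cohInfo, vN_eq_sum_negMulLog hσ, vN_eq_sum_negMulLog hρ.1] at hIc
    field_simp at hIc
    rw [Fintype.card_fin, Nat.cast_pow, Nat.cast_ofNat, Real.log_pow]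
    linarith
  have hprod := eq_one_kronecker_of_entropy_eq hρ hσ hE.trace_idTensor_maxEnt hS
  rw [hE.apply_eq_trace_smul hprod, hE.apply_eq_trace_smul hprod, trace_outer, trace_outer, h₁, h₂]
end
end

section
/- Let O be any complex 4×4 matrix regarded as an operator on ℂ²⊗ℂ². Then the Haar average over V in the unitary group U(2) satisfies ∫ (V⊗V) O (V⊗V)† dV = a·I + b·𝒮, where a = (Tr O − (1/2)Tr(O𝒮))/3 and b = (Tr(O𝒮) − (1/2)Tr O)/3. -/
open Matrix Kronecker MeasureTheory

noncomputable section

/-- The swap operator `𝒮` on `ℂ² ⊗ ℂ²`, `𝒮(u ⊗ v) = v ⊗ u`. -/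
def swapOp : Matrix (Fin 2 × Fin 2) (Fin 2 × Fin 2) ℂ :=
  Matrix.of fun p q => if p.1 = q.2 ∧ p.2 = q.1 then 1 else 0

/-- The single-site operators `O_0 = I/4` and `O_1 = 𝒮/2` on a doubled qubit. -/
noncomputable def O01 (b : Fin 2) : Matrix (Fin 2 × Fin 2) (Fin 2 × Fin 2) ℂ :=
  if b = 0 then (4 : ℂ)⁻¹ • 1 else (2 : ℂ)⁻¹ • swapOp

/-- Tensor product over the sites of single-site operators on the doubled space. -/
def tensorSites {ι : Type*} [Fintype ι]
    (f : ι → Matrix (Fin 2 × Fin 2) (Fin 2 × Fin 2) ℂ) :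
    Matrix (ι → Fin 2 × Fin 2) (ι → Fin 2 × Fin 2) ℂ :=
  Matrix.of fun x y => ∏ i, f i (x i) (y i)

/-- The symmetrized basis operator
`|S⟩ = C(n,S)⁻¹ ∑_{|σ| = S} ⊗ᵢ O_{σᵢ}` on the doubled space. -/
noncomputable def basisS {ι : Type*} [Fintype ι] [DecidableEq ι] (S : ℕ) :
    Matrix (ι → Fin 2 × Fin 2) (ι → Fin 2 × Fin 2) ℂ :=
  (((Fintype.card ι).choose S : ℂ))⁻¹ •
    ∑ σ ∈ Finset.univ.filter
        (fun σ : ι → Fin 2 => (Finset.univ.filter fun i => σ i = 1).card = S),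
      tensorSites fun i => O01 (σ i)

/-- `𝕊 = 𝒮^{⊗n}`: the two-copy swap applied to every site. -/
def fullSwapSites (ι : Type*) [Fintype ι] :
    Matrix (ι → Fin 2 × Fin 2) (ι → Fin 2 × Fin 2) ℂ :=
  tensorSites fun _ => swapOp

instance matrixMeasurableSpace {m n : Type*} : MeasurableSpace (Matrix m n ℂ) :=
  inferInstanceAs (MeasurableSpace (m → n → ℂ))

/-- `μ` is a (left-invariant) Haar probability measure on a group of unitaries. -/
def IsHaarProb {G : Type*} [Group G] [MeasurableSpace G] (μ : MeasureTheory.Measure G) : Prop :=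
  MeasureTheory.IsProbabilityMeasure μ ∧
    ∀ (g : G) (s : Set G), MeasurableSet s → μ ((g * ·) ⁻¹' s) = μ s

/-- The unitary group `U(2)` acting on one qubit. -/
abbrev U2 := Matrix.unitaryGroup (Fin 2) ℂ

/-- Entrywise Bochner integral of the single-qubit twirl
`V ↦ (V ⊗ V) O (V ⊗ V)†` over `μ`. -/
noncomputable def twirlAvg (μ : MeasureTheory.Measure U2)
    (O : Matrix (Fin 2 × Fin 2) (Fin 2 × Fin 2) ℂ) :
    Matrix (Fin 2 × Fin 2) (Fin 2 × Fin 2) ℂ :=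
  Matrix.of fun p q =>
    ∫ V : U2,
      ((((V : Matrix (Fin 2) (Fin 2) ℂ) ⊗ₖ (V : Matrix (Fin 2) (Fin 2) ℂ)) * O *
        (((V : Matrix (Fin 2) (Fin 2) ℂ) ⊗ₖ (V : Matrix (Fin 2) (Fin 2) ℂ))ᴴ)) p q) ∂μ

lemma mul_swapOp_apply (A : Matrix (Fin 2 × Fin 2) (Fin 2 × Fin 2) ℂ) (p q : Fin 2 × Fin 2) :
    (A * swapOp) p q = A p q.swap := by
  obtain ⟨a, b⟩ := q
  fin_cases a <;> fin_cases b <;>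
    simp [Matrix.mul_apply, swapOp, Fintype.sum_prod_type, Fin.sum_univ_two]

lemma swapOp_mul_apply (A : Matrix (Fin 2 × Fin 2) (Fin 2 × Fin 2) ℂ) (p q : Fin 2 × Fin 2) :
    (swapOp * A) p q = A p.swap q := by
  obtain ⟨a, b⟩ := p
  fin_cases a <;> fin_cases b <;>
    simp [Matrix.mul_apply, swapOp, Fintype.sum_prod_type, Fin.sum_univ_two]

lemma kronecker_self_mul_swapOp (A : Matrix (Fin 2) (Fin 2) ℂ) :
    (A ⊗ₖ A) * swapOp = swapOp * (A ⊗ₖ A) := by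
  ext p q
  simp [mul_swapOp_apply, swapOp_mul_apply, kroneckerMap_apply, mul_comm]

/-- An operator commuting with every `V ⊗ V`, `V ∈ U(2)`, is a combination of `1` and `swapOp`. -/
lemma eq_smul_one_add_smul_swapOp_of_commute
    (M : Matrix (Fin 2 × Fin 2) (Fin 2 × Fin 2) ℂ)
    (h : ∀ g : U2, ((g : Matrix (Fin 2) (Fin 2) ℂ) ⊗ₖ (g : Matrix (Fin 2) (Fin 2) ℂ)) * M =
      M * ((g : Matrix (Fin 2) (Fin 2) ℂ) ⊗ₖ (g : Matrix (Fin 2) (Fin 2) ℂ))) :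
    M = M (0, 1) (0, 1) • (1 : Matrix (Fin 2 × Fin 2) (Fin 2 × Fin 2) ℂ) +
      M (0, 1) (1, 0) • swapOp := by
  have phase := h ⟨!![1, 0; 0, Complex.I], by
    rw [mem_unitaryGroup_iff]
    ext i j
    fin_cases i <;> fin_cases j <;> simp [Matrix.mul_apply, Fin.sum_univ_two, star_apply]⟩
  have flip := h ⟨!![0, 1; 1, 0], by
    rw [mem_unitaryGroup_iff]
    ext i j
    fin_cases i <;> fin_cases j <;> simp [Matrix.mul_apply, Fin.sum_univ_two, star_apply]⟩
  have reflection := h ⟨!![3 / 5, 4 / 5; 4 / 5, -3 / 5], by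
    rw [mem_unitaryGroup_iff]
    ext i j
    fin_cases i <;> fin_cases j <;>
      norm_num [Matrix.mul_apply, Fin.sum_univ_two, star_apply, Complex.conj_ofNat]⟩
  replace reflection := congrFun (congrFun reflection (0, 0)) (0, 1)
  simp only [← Matrix.ext_iff, Matrix.mul_apply, Fintype.sum_prod_type, Fin.sum_univ_two,
    kroneckerMap_apply, Prod.forall, Fin.forall_fin_two] at phase flip reflection
  simp at phase flip reflection
  have eq_zero (x : ℂ) (hx : x = x * Complex.I) : x = 0 := by
    have hI : (1 : ℂ) - Complex.I ≠ 0 := by simp [Complex.ext_iff]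
    exact (mul_eq_zero.mp (by linear_combination hx : x * (1 - Complex.I) = 0)).resolve_right hI
  obtain ⟨⟨⟨h0001, h0010, h0011⟩, ⟨h0100, -⟩, -⟩, ⟨⟨h1000, -⟩, -⟩, -⟩ := phase
  obtain ⟨⟨⟨⟨f1100, f1101⟩, f1110, f1111⟩, ⟨f1000, f1001⟩, f1010, f1011⟩, -⟩ := flip
  replace h0001 := eq_zero _ h0001
  replace h0010 := eq_zero _ h0010
  replace h0011 : M (0, 0) (1, 1) = 0 := by linear_combination h0011 / 2
  replace h0100 : M (0, 1) (0, 0) = 0 := eq_zero _ (by linear_combination -h0100)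
  replace h1000 : M (1, 0) (0, 0) = 0 := eq_zero _ (by linear_combination -h1000)
  have h0000 : M (0, 0) (0, 0) = M (0, 1) (0, 1) + M (0, 1) (1, 0) := by
    rw [f1101, f1001, h0001, h0010, h0011] at reflection
    linear_combination -(25 / 12) * reflection
  have h0111 : M (0, 1) (1, 1) = 0 := f1000.symm.trans h1000
  ext ⟨a, b⟩ ⟨c, d⟩
  fin_cases a <;> fin_cases b <;> fin_cases c <;> fin_cases d <;>
    simp [swapOp, f1100, f1101, f1110, f1111, f1001, f1010, f1011, h0000, h0001, h0010, h0011,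
      h0100, h0111, h1000]

lemma measurable_unitary_apply (i j : Fin 2) :
    Measurable fun V : U2 => (V : Matrix (Fin 2) (Fin 2) ℂ) i j :=
  (measurable_pi_apply j).comp ((measurable_pi_apply i).comp measurable_subtype_coe)

lemma measurable_unitary_mul_left (g : U2) : Measurable fun V : U2 => g * V := by
  refine Measurable.subtype_mk ?_
  refine measurable_pi_lambda _ fun i => measurable_pi_lambda _ fun j => ?_
  simp only [Matrix.mul_apply]
  exact Finset.measurable_sum _ fun k _ => (measurable_unitary_apply k j).const_mul _

/-- The integrand `V ↦ (V ⊗ V) O (V ⊗ V)†` of the twirl. -/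
def twirl (O : Matrix (Fin 2 × Fin 2) (Fin 2 × Fin 2) ℂ) (V : U2) :
    Matrix (Fin 2 × Fin 2) (Fin 2 × Fin 2) ℂ :=
  ((V : Matrix (Fin 2) (Fin 2) ℂ) ⊗ₖ (V : Matrix (Fin 2) (Fin 2) ℂ)) * O *
    ((V : Matrix (Fin 2) (Fin 2) ℂ) ⊗ₖ (V : Matrix (Fin 2) (Fin 2) ℂ))ᴴ

lemma conjTranspose_kronecker_self_mul (V : U2) :
    ((V : Matrix (Fin 2) (Fin 2) ℂ) ⊗ₖ (V : Matrix (Fin 2) (Fin 2) ℂ))ᴴ *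
      ((V : Matrix (Fin 2) (Fin 2) ℂ) ⊗ₖ (V : Matrix (Fin 2) (Fin 2) ℂ)) = 1 := by
  have hV : (V : Matrix (Fin 2) (Fin 2) ℂ)ᴴ * (V : Matrix (Fin 2) (Fin 2) ℂ) = 1 :=
    mem_unitaryGroup_iff'.mp V.2
  rw [conjTranspose_kronecker, ← mul_kronecker_mul, hV, one_kronecker_one]

lemma twirl_mul_left (O : Matrix (Fin 2 × Fin 2) (Fin 2 × Fin 2) ℂ) (g V : U2) :
    twirl O (g * V) = twirl (twirl O V) g := by
  simp only [twirl, Submonoid.coe_mul, mul_kronecker_mul, conjTranspose_mul, Matrix.mul_assoc]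

lemma trace_twirl (O : Matrix (Fin 2 × Fin 2) (Fin 2 × Fin 2) ℂ) (V : U2) :
    (twirl O V).trace = O.trace := by
  rw [twirl, Matrix.trace_mul_comm, ← Matrix.mul_assoc, conjTranspose_kronecker_self_mul,
    Matrix.one_mul]

lemma twirl_mul_swapOp (O : Matrix (Fin 2 × Fin 2) (Fin 2 × Fin 2) ℂ) (V : U2) :
    twirl O V * swapOp = twirl (O * swapOp) V := by
  simp only [twirl, conjTranspose_kronecker, Matrix.mul_assoc, kronecker_self_mul_swapOp]

lemma integrable_twirl_apply (μ : Measure U2) [IsFiniteMeasure μ]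
    (O : Matrix (Fin 2 × Fin 2) (Fin 2 × Fin 2) ℂ) (p q : Fin 2 × Fin 2) :
    Integrable (fun V => twirl O V p q) μ := by
  have hK (V : U2) (a b : Fin 2 × Fin 2) :
      ‖((V : Matrix (Fin 2) (Fin 2) ℂ) ⊗ₖ (V : Matrix (Fin 2) (Fin 2) ℂ)) a b‖ ≤ 1 := by
    rw [kroneckerMap_apply, norm_mul]
    exact mul_le_one₀ (entry_norm_bound_of_unitary V.2 _ _) (norm_nonneg _)
      (entry_norm_bound_of_unitary V.2 _ _)
  have hKm (a b : Fin 2 × Fin 2) : Measurable fun V : U2 =>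
      ((V : Matrix (Fin 2) (Fin 2) ℂ) ⊗ₖ (V : Matrix (Fin 2) (Fin 2) ℂ)) a b :=
    (measurable_unitary_apply _ _).mul (measurable_unitary_apply _ _)
  simp only [twirl, Matrix.mul_apply, Finset.sum_mul, conjTranspose_apply]
  refine integrable_finsetSum _ fun j _ => integrable_finsetSum _ fun i _ => ?_
  refine Integrable.of_bound (C := ‖O i j‖) ?_ (Filter.Eventually.of_forall fun V => ?_)
  · exact (((hKm p i).mul_const _).mul
      (Complex.continuous_conj.measurable.comp (hKm q j))).aestronglyMeasurable
  · rw [norm_mul, norm_mul, norm_star]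
    calc _ ≤ 1 * ‖O i j‖ * 1 := by gcongr <;> exact hK _ _ _
      _ = _ := by ring

lemma mul_twirlAvg_mul_apply (μ : Measure U2) [IsFiniteMeasure μ]
    (O A B : Matrix (Fin 2 × Fin 2) (Fin 2 × Fin 2) ℂ) (p q : Fin 2 × Fin 2) :
    (A * twirlAvg μ O * B) p q = ∫ V, (A * twirl O V * B) p q ∂μ := by
  have hint := integrable_twirl_apply μ O
  simp only [Matrix.mul_apply, Finset.sum_mul]
  rw [integral_finsetSum _ fun j _ => integrable_finsetSum _ fun i _ =>
    ((hint i j).const_mul _).mul_const _]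
  refine Finset.sum_congr rfl fun j _ => ?_
  rw [integral_finsetSum _ fun i _ => ((hint i j).const_mul _).mul_const _]
  refine Finset.sum_congr rfl fun i _ => ?_
  rw [integral_mul_const, integral_const_mul]
  rfl

lemma trace_twirlAvg (μ : Measure U2) [IsProbabilityMeasure μ]
    (O : Matrix (Fin 2 × Fin 2) (Fin 2 × Fin 2) ℂ) :
    (twirlAvg μ O).trace = O.trace := by
  calc (twirlAvg μ O).trace = ∑ p, ∫ V, twirl O V p p ∂μ := rfl
    _ = ∫ V, (twirl O V).trace ∂μ :=
      (integral_finsetSum _ fun p _ => integrable_twirl_apply μ O p p).symm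
    _ = O.trace := by simp [trace_twirl]

lemma twirlAvg_mul_swapOp (μ : Measure U2) [IsFiniteMeasure μ]
    (O : Matrix (Fin 2 × Fin 2) (Fin 2 × Fin 2) ℂ) :
    twirlAvg μ O * swapOp = twirlAvg μ (O * swapOp) := by
  ext p q
  have h := mul_twirlAvg_mul_apply μ O 1 swapOp p q
  simp only [Matrix.one_mul, twirl_mul_swapOp] at h
  exact h

lemma twirl_twirlAvg (μ : Measure U2) (hμ : IsHaarProb μ)
    (O : Matrix (Fin 2 × Fin 2) (Fin 2 × Fin 2) ℂ) (g : U2) :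
    twirl (twirlAvg μ O) g = twirlAvg μ O := by
  have := hμ.1
  have hg : MeasurePreserving (fun V : U2 => g * V) μ μ :=
    ⟨measurable_unitary_mul_left g, Measure.ext fun s hs => by
      rw [Measure.map_apply (measurable_unitary_mul_left g) hs, hμ.2 g s hs]⟩
  ext p q
  calc twirl (twirlAvg μ O) g p q = ∫ V, twirl (twirl O V) g p q ∂μ :=
        mul_twirlAvg_mul_apply μ O _ _ p q
    _ = ∫ V, twirl O (g * V) p q ∂μ := by simp only [twirl_mul_left]
    _ = ∫ V, twirl O V p q ∂(μ.map fun V => g * V) := by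
      rw [integral_map hg.measurable.aemeasurable]
      rw [hg.map_eq]
      exact (integrable_twirl_apply μ O p q).aestronglyMeasurable
    _ = twirlAvg μ O p q := by rw [hg.map_eq]; rfl

lemma kronecker_self_mul_twirlAvg (μ : Measure U2) (hμ : IsHaarProb μ)
    (O : Matrix (Fin 2 × Fin 2) (Fin 2 × Fin 2) ℂ) (g : U2) :
    ((g : Matrix (Fin 2) (Fin 2) ℂ) ⊗ₖ (g : Matrix (Fin 2) (Fin 2) ℂ)) * twirlAvg μ O =
      twirlAvg μ O * ((g : Matrix (Fin 2) (Fin 2) ℂ) ⊗ₖ (g : Matrix (Fin 2) (Fin 2) ℂ)) := by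
  conv_rhs => rw [← twirl_twirlAvg μ hμ O g]
  rw [twirl, Matrix.mul_assoc _ _ᴴ, conjTranspose_kronecker_self_mul, Matrix.mul_one]

/-- For any operator `O` on `ℂ² ⊗ ℂ²`, the Haar average over `V ∈ U(2)`
satisfies `∫ (V⊗V) O (V⊗V)† dV = a·I + b·𝒮` with
`a = (Tr O − (1/2)Tr(O𝒮))/3` and `b = (Tr(O𝒮) − (1/2)Tr O)/3`. -/
theorem haar_twirl_eq
    (μ : Measure U2) (hμ : IsHaarProb μ)
    (O : Matrix (Fin 2 × Fin 2) (Fin 2 × Fin 2) ℂ) :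
    twirlAvg μ O =
      ((O.trace - (O * swapOp).trace / 2) / 3) • (1 : Matrix (Fin 2 × Fin 2) (Fin 2 × Fin 2) ℂ) +
        (((O * swapOp).trace - O.trace / 2) / 3) • swapOp := by
  have := hμ.1
  have hM := eq_smul_one_add_smul_swapOp_of_commute _ (kronecker_self_mul_twirlAvg μ hμ O)
  have htr := trace_twirlAvg μ O
  have htrS := trace_twirlAvg μ (O * swapOp)
  rw [← twirlAvg_mul_swapOp] at htrS
  have hS : swapOp.trace = 2 := by
    simp only [Matrix.trace, Fintype.sum_prod_type, Fin.sum_univ_two, diag_apply]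
    norm_num [swapOp]
  have hSS : swapOp * swapOp = 1 := by
    ext p q
    rw [mul_swapOp_apply]
    simp [swapOp, Matrix.one_apply, Prod.ext_iff]
  rw [hM] at htr htrS
  simp only [Matrix.add_mul, Matrix.smul_mul, Matrix.one_mul, hSS, trace_add, trace_smul, hS,
    trace_one, Fintype.card_prod, Fintype.card_fin, smul_eq_mul] at htr htrS
  push_cast at htr htrS
  rw [hM, ← htr, ← htrS]
  congr 2 <;> ring
end
end

section
/- Identify (ℂ⁴)⊗(ℂ⁴) with (ℂ²⊗ℂ²)⊗(ℂ²⊗ℂ²) by grouping together the two copies of qubit 1 and the two copies of qubit 2. Then the Haar average over V in U(4) (V acting on two qubits, V⊗V on the two copies) satisfies: ∫ (V⊗V)[(I/4)⊗(𝒮/2)](V⊗V)† dV = (4/5)(I/4)⊗(I/4) + (1/5)(𝒮/2)⊗(𝒮/2); the same holds for the input (𝒮/2)⊗(I/4); and the operators (I/4)⊗(I/4) and (𝒮/2)⊗(𝒮/2) are fixed by this average. -/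
open Matrix Kronecker MeasureTheory

noncomputable section

/-- The unitary group `U(4)` acting on two qubits (`ℂ² ⊗ ℂ²`). -/
abbrev U4 := Matrix.unitaryGroup (Fin 2 × Fin 2) ℂ

/-- `V ⊗ V` for a two-qubit unitary `V`, with the doubled four-qubit space reordered
qubit-wise: the first factor carries (copy 1, copy 2) of qubit 1 and the second factor
carries (copy 1, copy 2) of qubit 2. -/
def doubled2 (V : Matrix (Fin 2 × Fin 2) (Fin 2 × Fin 2) ℂ) :
    Matrix ((Fin 2 × Fin 2) × (Fin 2 × Fin 2)) ((Fin 2 × Fin 2) × (Fin 2 × Fin 2)) ℂ :=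
  Matrix.of fun p q =>
    V (p.1.1, p.2.1) (q.1.1, q.2.1) * V (p.1.2, p.2.2) (q.1.2, q.2.2)

/-- Entrywise Bochner integral of the two-qubit twirl `V ↦ (V⊗V) O (V⊗V)†` over `μ`,
in the qubit-wise ordering of the doubled space. -/
noncomputable def twirl4Avg (μ : MeasureTheory.Measure U4)
    (O : Matrix ((Fin 2 × Fin 2) × (Fin 2 × Fin 2)) ((Fin 2 × Fin 2) × (Fin 2 × Fin 2)) ℂ) :
    Matrix ((Fin 2 × Fin 2) × (Fin 2 × Fin 2)) ((Fin 2 × Fin 2) × (Fin 2 × Fin 2)) ℂ :=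
  Matrix.of fun p q =>
    ∫ V : U4,
      ((doubled2 (V : Matrix (Fin 2 × Fin 2) (Fin 2 × Fin 2) ℂ) * O *
        (doubled2 (V : Matrix (Fin 2 × Fin 2) (Fin 2 × Fin 2) ℂ))ᴴ) p q) ∂μ

/-- The swap of the two tensor factors of `ℂᵈ ⊗ ℂᵈ`. -/
def factorSwap (d : Type*) [DecidableEq d] : Matrix (d × d) (d × d) ℂ :=
  Matrix.of fun p q => if p.1 = q.2 ∧ p.2 = q.1 then 1 else 0

lemma factorSwap_eq_ite {d : Type*} [DecidableEq d] (p q : d × d) :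
    factorSwap d p q = if q = p.swap then 1 else 0 := by
  simp only [factorSwap, Matrix.of_apply, Prod.ext_iff, Prod.fst_swap, Prod.snd_swap]
  congr 1
  exact propext ⟨fun h => ⟨h.2.symm, h.1.symm⟩, fun h => ⟨h.2.symm, h.1.symm⟩⟩

section TwoFoldTwirl

variable {d : Type*} [Fintype d] [DecidableEq d]

lemma factorSwap_mul_apply (X : Matrix (d × d) (d × d) ℂ) (p q : d × d) :
    (factorSwap d * X) p q = X p.swap q := by
  simp [Matrix.mul_apply, factorSwap_eq_ite]

lemma mul_factorSwap_apply (X : Matrix (d × d) (d × d) ℂ) (p q : d × d) :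
    (X * factorSwap d) p q = X p q.swap := by
  have h (r : d × d) : q = r.swap ↔ r = q.swap := by
    constructor <;> rintro rfl <;> simp
  simp [Matrix.mul_apply, factorSwap_eq_ite, h]

lemma factorSwap_mul_self : factorSwap d * factorSwap d = 1 := by
  ext p q
  rw [factorSwap_mul_apply, factorSwap_eq_ite, Prod.swap_swap, Matrix.one_apply]
  simp [eq_comm]

lemma trace_factorSwap : (factorSwap d).trace = Fintype.card d := by
  simp only [Matrix.trace, Matrix.diag_apply, factorSwap, Matrix.of_apply,
    Fintype.sum_prod_type]
  have h (x y : d) : (x = y ∧ y = x) ↔ x = y := ⟨And.left, fun h => ⟨h, h.symm⟩⟩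
  simp [h]

lemma commute_factorSwap_kronecker_self (V : Matrix d d ℂ) :
    Commute (factorSwap d) (V ⊗ₖ V) := by
  ext p q
  rw [factorSwap_mul_apply, mul_factorSwap_apply]
  simp [Matrix.kroneckerMap_apply, mul_comm]

section Commutant

variable {M : Matrix (d × d) (d × d) ℂ}

lemma diagonal_mem_unitaryGroup {θ : d → ℂ} (hθ : ∀ i, star (θ i) * θ i = 1) :
    Matrix.diagonal θ ∈ Matrix.unitaryGroup d ℂ := by
  rw [Matrix.mem_unitaryGroup_iff', Matrix.star_eq_conjTranspose,
    Matrix.diagonal_conjTranspose, Matrix.diagonal_mul_diagonal, ← Matrix.diagonal_one]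
  congr 1
  exact funext hθ

lemma apply_eq_zero_of_commute
    (hM : ∀ W ∈ Matrix.unitaryGroup d ℂ, Commute (W ⊗ₖ W) M) {i j k l : d}
    (h₁ : ¬(i = k ∧ j = l)) (h₂ : ¬(i = l ∧ j = k)) : M (i, j) (k, l) = 0 := by
  have key (x : d) : ((if i = x then Complex.I else 1) * (if j = x then Complex.I else 1)) *
      M (i, j) (k, l) =
      M (i, j) (k, l) * ((if k = x then Complex.I else 1) * (if l = x then Complex.I else 1)) := by
    have hW := hM (Matrix.diagonal fun y => if y = x then Complex.I else 1)
      (diagonal_mem_unitaryGroup fun y => by split_ifs <;> simp)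
    have := congrFun (congrFun hW.eq (i, j)) (k, l)
    simpa only [Matrix.diagonal_kronecker_diagonal, Matrix.diagonal_mul,
      Matrix.mul_diagonal] using this
  by_contra hne
  have cancel (x : d) : ((if i = x then Complex.I else 1) * (if j = x then Complex.I else 1)) =
      ((if k = x then Complex.I else 1) * (if l = x then Complex.I else 1)) :=
    mul_left_cancel₀ hne ((mul_comm _ _).trans (key x))
  have hI : Complex.I ≠ 1 := fun h => by simpa using congrArg Complex.im h
  have hite {y z : d} (h : (if y = y then Complex.I else 1) = if z = y then Complex.I else 1) :
      z = y := by
    by_contra hzy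
    exact hI (by simpa [hzy] using h)
  have hne0 (y z : d) : (if y = z then Complex.I else 1) ≠ 0 := by split_ifs <;> simp
  rcases eq_or_ne k i with rfl | hki
  · exact h₁ ⟨rfl, (hite (mul_left_cancel₀ (hne0 k j) (cancel j))).symm⟩
  · rcases eq_or_ne l i with rfl | hli
    · refine h₂ ⟨rfl, (hite (mul_left_cancel₀ (hne0 l j) ((cancel j).trans (mul_comm _ _)))).symm⟩
    · have h := cancel i
      by_cases hji : j = i
      · norm_num [hki, hli, hji] at h
      · exact hI (by simpa [hki, hli, hji] using h)

lemma permMatrix_mem_unitaryGroup (σ : Equiv.Perm d) :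
    σ.permMatrix ℂ ∈ Matrix.unitaryGroup d ℂ := by
  rw [Matrix.mem_unitaryGroup_iff, Matrix.star_eq_conjTranspose, Matrix.conjTranspose_permMatrix,
    ← Matrix.permMatrix_mul]
  simp

lemma apply_perm_of_commute
    (hM : ∀ W ∈ Matrix.unitaryGroup d ℂ, Commute (W ⊗ₖ W) M) (σ : Equiv.Perm d) (i j k l : d) :
    M (σ i, σ j) (σ k, σ l) = M (i, j) (k, l) := by
  have hW := hM _ (permMatrix_mem_unitaryGroup σ)
  have h := congrFun (congrFun hW.eq (i, j)) (σ k, σ l)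
  simpa [Matrix.mul_apply, Fintype.sum_prod_type, Matrix.kroneckerMap_apply,
    Equiv.Perm.permMatrix, PEquiv.toMatrix_apply, ite_and, mul_ite, ite_mul] using h

/-- A unitary with all entries nonzero: the phase `i` on the uniform vector,
the identity on its complement. -/
lemma exists_mem_unitaryGroup_forall_apply_ne_zero [Nonempty d] :
    ∃ W ∈ Matrix.unitaryGroup d ℂ, ∀ i j, W i j ≠ 0 := by
  have hn : (Fintype.card d : ℂ) ≠ 0 := by simp
  set c : ℂ := (Complex.I - 1) / Fintype.card d with hc
  have hJ : (Matrix.of fun _ _ => 1 : Matrix d d ℂ) * (Matrix.of fun _ _ => 1) =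
      (Fintype.card d : ℂ) • Matrix.of fun _ _ => 1 := by
    ext; simp [Matrix.mul_apply]
  refine ⟨1 + c • Matrix.of fun _ _ => 1, ?_, fun i j => ?_⟩
  · have hJs : (Matrix.of fun _ _ => 1 : Matrix d d ℂ)ᴴ = Matrix.of fun _ _ => 1 := by
      ext; simp
    rw [Matrix.mem_unitaryGroup_iff, Matrix.star_eq_conjTranspose, Matrix.conjTranspose_add,
      Matrix.conjTranspose_smul, hJs, Matrix.conjTranspose_one, add_mul, mul_add, mul_add,
      smul_mul_smul_comm, hJ, one_mul, mul_one, one_mul, add_assoc, ← add_assoc, smul_smul,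
      add_assoc, ← add_smul, ← add_smul]
    have : star c + (c + c * star c * Fintype.card d) = 0 := by
      have hs : star c = (-Complex.I - 1) / Fintype.card d := by simp [hc]
      rw [hs, hc]
      field_simp
      ring_nf
      simp
    rw [this, zero_smul, add_zero]
  · have him : c.im ≠ 0 := by
      rw [hc, Complex.div_natCast_im]
      simp
    intro h
    apply him
    have := congrArg Complex.im h
    rcases eq_or_ne i j with rfl | hij
    · simpa using this
    · simpa [hij] using this

/-- Schur–Weyl duality for two copies: the commutant of `{W ⊗ W}` is spanned by the
identity and the swap. -/
theorem exists_eq_smul_one_add_smul_factorSwap [Nontrivial d]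
    (hM : ∀ W ∈ Matrix.unitaryGroup d ℂ, Commute (W ⊗ₖ W) M) :
    ∃ a b : ℂ, M = a • 1 + b • factorSwap d := by
  obtain ⟨x, y, hxy⟩ := exists_pair_ne d
  have htrans {i j : d} (hij : i ≠ j) : ∃ σ : Equiv.Perm d, σ x = i ∧ σ y = j := by
    have hj : Equiv.swap x i j ≠ x := fun h => hij <| by
      simpa using (congrArg (Equiv.swap x i) h).symm
    refine ⟨Equiv.swap x i * Equiv.swap y (Equiv.swap x i j), ?_, ?_⟩
    · simp [Equiv.swap_apply_of_ne_of_ne hxy hj.symm]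
    · simp
  have hdiag (i : d) {j : d} (hij : i ≠ j) :
      M (i, i) (i, i) = M (i, j) (i, j) + M (j, i) (i, j) := by
    have : Nonempty d := ⟨x⟩
    obtain ⟨W, hW, hne⟩ := exists_mem_unitaryGroup_forall_apply_ne_zero (d := d)
    have h := congrFun (congrFun (hM W hW).eq (i, i)) (i, j)
    rw [Matrix.mul_apply, Matrix.mul_apply,
      Finset.sum_eq_add (i, j) (j, i) (by simp [hij]),
      Finset.sum_eq_single (i, i)] at h
    · simp only [Matrix.kroneckerMap_apply] at h
      apply mul_left_cancel₀ (mul_ne_zero (hne i i) (hne i j))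
      linear_combination -h
    · rintro ⟨k, l⟩ - hkl
      rw [apply_eq_zero_of_commute hM, zero_mul]
      · rintro ⟨rfl, rfl⟩; exact hkl rfl
      · rintro ⟨rfl, rfl⟩; exact hkl rfl
    · simp
    · rintro ⟨k, l⟩ - ⟨h₁, h₂⟩
      rw [apply_eq_zero_of_commute hM, mul_zero]
      · rintro ⟨rfl, rfl⟩; exact h₁ rfl
      · rintro ⟨rfl, rfl⟩; exact h₂ rfl
    · simp
    · simp
  refine ⟨M (x, y) (x, y), M (y, x) (x, y), ?_⟩
  have hoff {i j : d} (hij : i ≠ j) : M (i, j) (i, j) = M (x, y) (x, y) ∧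
      M (j, i) (i, j) = M (y, x) (x, y) := by
    obtain ⟨σ, rfl, rfl⟩ := htrans hij
    exact ⟨apply_perm_of_commute hM σ _ _ _ _, apply_perm_of_commute hM σ _ _ _ _⟩
  ext ⟨i, j⟩ ⟨k, l⟩
  simp only [Matrix.add_apply, Matrix.smul_apply, Matrix.one_apply, factorSwap,
    Matrix.of_apply, Prod.mk.injEq, smul_eq_mul]
  by_cases h₁ : i = k ∧ j = l
  · obtain ⟨rfl, rfl⟩ := h₁
    rcases eq_or_ne i j with rfl | hij
    · obtain ⟨z, hz⟩ := exists_ne i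
      rw [hdiag i hz.symm, (hoff hz.symm).1, (hoff hz.symm).2]
      simp
    · rw [(hoff hij).1]
      simp [hij]
  · by_cases h₂ : i = l ∧ j = k
    · obtain ⟨rfl, rfl⟩ := h₂
      have hij : j ≠ i := fun h => h₁ ⟨h.symm, h⟩
      rw [(hoff hij).2]
      simp [hij]
    · rw [apply_eq_zero_of_commute hM h₁ h₂]
      simp [h₁, h₂]

end Commutant

/-- The entrywise average of `(V ⊗ V) X (V ⊗ V)†` over `V`. -/
def twoFoldTwirl (μ : Measure (Matrix.unitaryGroup d ℂ)) (X : Matrix (d × d) (d × d) ℂ) :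
    Matrix (d × d) (d × d) ℂ :=
  Matrix.of fun p q => ∫ V : Matrix.unitaryGroup d ℂ,
    ((V.1 ⊗ₖ V.1) * X * (V.1 ⊗ₖ V.1)ᴴ) p q ∂μ

lemma measurable_unitaryGroup_apply (i j : d) :
    Measurable fun V : Matrix.unitaryGroup d ℂ => V.1 i j :=
  (measurable_pi_apply j).comp ((measurable_pi_apply i).comp measurable_subtype_coe)

lemma measurable_unitaryGroup_of_apply {f : Matrix.unitaryGroup d ℂ → Matrix.unitaryGroup d ℂ}
    (hf : ∀ i j, Measurable fun V => (f V).1 i j) : Measurable f :=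
  (measurable_pi_lambda _ fun i => measurable_pi_lambda _ fun j => hf i j :
    Measurable fun V => (f V).1).subtype_mk

instance measurableMul_unitaryGroup : MeasurableMul (Matrix.unitaryGroup d ℂ) where
  measurable_const_mul g := measurable_unitaryGroup_of_apply fun i j => by
    simp only [Submonoid.coe_mul, Matrix.mul_apply]
    exact Finset.measurable_sum _ fun k _ => (measurable_unitaryGroup_apply k j).const_mul _
  measurable_mul_const g := measurable_unitaryGroup_of_apply fun i j => by
    simp only [Submonoid.coe_mul, Matrix.mul_apply]
    exact Finset.measurable_sum _ fun k _ => (measurable_unitaryGroup_apply i k).mul_const _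

variable {μ : Measure (Matrix.unitaryGroup d ℂ)}

lemma IsHaarProb.integral_mul_left (hμ : IsHaarProb μ) (g : Matrix.unitaryGroup d ℂ)
    (f : Matrix.unitaryGroup d ℂ → ℂ) : ∫ V, f (g * V) ∂μ = ∫ V, f V ∂μ := by
  have : μ.IsMulLeftInvariant := ⟨fun g => Measure.ext fun s hs => by
    rw [Measure.map_apply (measurable_const_mul g) hs, hμ.2 g s hs]⟩
  exact integral_mul_left_eq_self f g

lemma integrable_conj_kronecker_self_apply [IsFiniteMeasure μ] (X : Matrix (d × d) (d × d) ℂ)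
    (p q : d × d) :
    Integrable (fun V : Matrix.unitaryGroup d ℂ =>
      ((V.1 ⊗ₖ V.1) * X * (V.1 ⊗ₖ V.1)ᴴ) p q) μ := by
  have hb (V : Matrix.unitaryGroup d ℂ) (i j : d) : ‖V.1 i j‖ ≤ 1 :=
    entry_norm_bound_of_unitary V.2 i j
  simp only [Matrix.mul_apply, Finset.sum_mul]
  refine integrable_finsetSum _ fun r _ => integrable_finsetSum _ fun s _ => ?_
  simp only [Matrix.conjTranspose_apply, Matrix.kroneckerMap_apply]
  have hm := measurable_unitaryGroup_apply (d := d)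
  refine Integrable.of_bound (C := ‖X s r‖) (Measurable.aestronglyMeasurable ?_)
    (Filter.Eventually.of_forall fun V => ?_)
  · exact (((hm _ _).mul (hm _ _)).mul_const _).mul
      (continuous_star.measurable.comp ((hm _ _).mul (hm _ _)))
  · simp only [norm_mul, norm_star]
    have h₁ := mul_le_one₀ (hb V p.1 s.1) (norm_nonneg _) (hb V p.2 s.2)
    have h₂ := mul_le_one₀ (hb V q.1 r.1) (norm_nonneg _) (hb V q.2 r.2)
    calc _ ≤ 1 * ‖X s r‖ * 1 := by gcongr
      _ = _ := by ring

lemma of_integral_mul_left {n : Type*} [Fintype n] {Ω : Type*} [MeasurableSpace Ω]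
    {ν : Measure Ω} {F : Ω → Matrix n n ℂ} (hF : ∀ p q, Integrable (fun ω => F ω p q) ν)
    (A : Matrix n n ℂ) :
    (Matrix.of fun p q => ∫ ω, (A * F ω) p q ∂ν) = A * Matrix.of fun p q => ∫ ω, F ω p q ∂ν := by
  ext p q
  simp only [Matrix.of_apply, Matrix.mul_apply]
  rw [integral_finsetSum _ fun r _ => (hF r q).const_mul _]
  simp only [integral_const_mul]

lemma of_integral_mul_right {n : Type*} [Fintype n] {Ω : Type*} [MeasurableSpace Ω]
    {ν : Measure Ω} {F : Ω → Matrix n n ℂ} (hF : ∀ p q, Integrable (fun ω => F ω p q) ν)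
    (A : Matrix n n ℂ) :
    (Matrix.of fun p q => ∫ ω, (F ω * A) p q ∂ν) = (Matrix.of fun p q => ∫ ω, F ω p q ∂ν) * A := by
  ext p q
  simp only [Matrix.of_apply, Matrix.mul_apply]
  rw [integral_finsetSum _ fun r _ => (hF p r).mul_const _]
  simp only [integral_mul_const]

lemma kronecker_self_conjTranspose_mul_self {W : Matrix d d ℂ}
    (hW : W ∈ Matrix.unitaryGroup d ℂ) : (W ⊗ₖ W)ᴴ * (W ⊗ₖ W) = 1 := by
  rw [Matrix.conjTranspose_kronecker, ← Matrix.mul_kronecker_mul, ← Matrix.star_eq_conjTranspose,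
    Matrix.mem_unitaryGroup_iff'.1 hW, Matrix.one_kronecker_one]

lemma kronecker_self_mul_conjTranspose_self {W : Matrix d d ℂ}
    (hW : W ∈ Matrix.unitaryGroup d ℂ) : (W ⊗ₖ W) * (W ⊗ₖ W)ᴴ = 1 :=
  mul_eq_one_comm.1 (kronecker_self_conjTranspose_mul_self hW)

/-- By left invariance, the twirl lands in the commutant of the two-copy unitaries. -/
lemma commute_twoFoldTwirl (hμ : IsHaarProb μ) (X : Matrix (d × d) (d × d) ℂ)
    {W : Matrix d d ℂ} (hW : W ∈ Matrix.unitaryGroup d ℂ) :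
    Commute (W ⊗ₖ W) (twoFoldTwirl μ X) := by
  have := hμ.1
  have hinv : (W ⊗ₖ W) * twoFoldTwirl μ X * (W ⊗ₖ W)ᴴ = twoFoldTwirl μ X := by
    have hF := integrable_conj_kronecker_self_apply (μ := μ) X
    rw [mul_assoc]
    unfold twoFoldTwirl
    rw [← of_integral_mul_right hF, ← of_integral_mul_left]
    · ext p q
      simp only [Matrix.of_apply]
      rw [← hμ.integral_mul_left ⟨W, hW⟩
        fun V => ((V.1 ⊗ₖ V.1) * X * (V.1 ⊗ₖ V.1)ᴴ) p q]
      congr 1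
      ext V
      simp only [Submonoid.coe_mul, Matrix.mul_kronecker_mul, Matrix.conjTranspose_mul,
        Matrix.mul_assoc]
    · intro p q
      simp only [Matrix.mul_apply (M := _ * _ * _)]
      exact integrable_finsetSum _ fun r _ => (hF p r).mul_const _
  calc (W ⊗ₖ W) * twoFoldTwirl μ X
      = (W ⊗ₖ W) * twoFoldTwirl μ X * ((W ⊗ₖ W)ᴴ * (W ⊗ₖ W)) := by
        rw [kronecker_self_conjTranspose_mul_self hW, mul_one]
    _ = twoFoldTwirl μ X * (W ⊗ₖ W) := by rw [← mul_assoc, hinv]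

lemma twoFoldTwirl_eq_self [IsProbabilityMeasure μ] {X : Matrix (d × d) (d × d) ℂ}
    (hX : ∀ V : Matrix d d ℂ, Commute X (V ⊗ₖ V)) : twoFoldTwirl μ X = X := by
  ext p q
  have h (V : Matrix.unitaryGroup d ℂ) : (V.1 ⊗ₖ V.1) * X * (V.1 ⊗ₖ V.1)ᴴ = X := by
    rw [← (hX V.1).eq, mul_assoc, kronecker_self_mul_conjTranspose_self V.2, mul_one]
  simp [twoFoldTwirl, h]

lemma trace_twoFoldTwirl_mul [IsProbabilityMeasure μ] (X : Matrix (d × d) (d × d) ℂ)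
    {A : Matrix (d × d) (d × d) ℂ} (hA : ∀ V : Matrix d d ℂ, Commute A (V ⊗ₖ V)) :
    (twoFoldTwirl μ X * A).trace = (X * A).trace := by
  have hF := integrable_conj_kronecker_self_apply (μ := μ) X
  have htr (V : Matrix.unitaryGroup d ℂ) :
      ((V.1 ⊗ₖ V.1) * X * (V.1 ⊗ₖ V.1)ᴴ * A).trace = (X * A).trace := by
    rw [Matrix.mul_assoc, Matrix.mul_assoc, Matrix.trace_mul_comm, Matrix.mul_assoc,
      Matrix.mul_assoc, (hA V.1).eq, ← Matrix.mul_assoc (V.1 ⊗ₖ V.1)ᴴ,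
      kronecker_self_conjTranspose_mul_self V.2, Matrix.one_mul]
  unfold twoFoldTwirl
  rw [← of_integral_mul_right hF]
  simp only [Matrix.trace, Matrix.diag_apply, Matrix.of_apply] at htr ⊢
  rw [← integral_finsetSum]
  · simp [htr]
  · intro p _
    simp only [Matrix.mul_apply (M := _ * _ * _)]
    exact integrable_finsetSum _ fun r _ => (hF p r).mul_const _

/-- The two-copy twirl of `X` is `a I + b F`, with `a` and `b` determined by
`tr X` and `tr (X F)`, where `F` is the swap. -/
theorem twoFoldTwirl_eq_smul_one_add_smul_factorSwap [Nontrivial d] (hμ : IsHaarProb μ)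
    (X : Matrix (d × d) (d × d) ℂ) :
    ∃ a b : ℂ, twoFoldTwirl μ X = a • 1 + b • factorSwap d ∧
      a * (Fintype.card d) ^ 2 + b * Fintype.card d = X.trace ∧
      a * Fintype.card d + b * (Fintype.card d) ^ 2 = (X * factorSwap d).trace := by
  have := hμ.1
  obtain ⟨a, b, hab⟩ := exists_eq_smul_one_add_smul_factorSwap
    (M := twoFoldTwirl μ X) fun W hW => commute_twoFoldTwirl hμ X hW
  refine ⟨a, b, hab, ?_, ?_⟩
  · have h := trace_twoFoldTwirl_mul (μ := μ) X (A := 1) fun V => Commute.one_left _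
    rw [hab, mul_one, mul_one, Matrix.trace_add, Matrix.trace_smul, Matrix.trace_smul,
      trace_factorSwap, Matrix.trace_one, Fintype.card_prod] at h
    rw [← h]
    simp [sq]
  · have h := trace_twoFoldTwirl_mul (μ := μ) X commute_factorSwap_kronecker_self
    rw [hab, add_mul, smul_mul_assoc, smul_mul_assoc, one_mul, factorSwap_mul_self,
      Matrix.trace_add, Matrix.trace_smul, Matrix.trace_smul,
      trace_factorSwap, Matrix.trace_one, Fintype.card_prod] at h
    rw [← h]
    simp [sq]

end TwoFoldTwirl

/-- The regrouping of the doubled two-qubit space from qubit-wise to copy-wise order. -/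
abbrev regroup : ((Fin 2 × Fin 2) × (Fin 2 × Fin 2)) ≃ ((Fin 2 × Fin 2) × (Fin 2 × Fin 2)) :=
  Equiv.prodProdProdComm (Fin 2) (Fin 2) (Fin 2) (Fin 2)

lemma doubled2_eq_submatrix (V : Matrix (Fin 2 × Fin 2) (Fin 2 × Fin 2) ℂ) :
    doubled2 V = (V ⊗ₖ V).submatrix regroup regroup := rfl

lemma twirl4Avg_submatrix (μ : Measure U4)
    (X : Matrix ((Fin 2 × Fin 2) × (Fin 2 × Fin 2)) ((Fin 2 × Fin 2) × (Fin 2 × Fin 2)) ℂ) :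
    twirl4Avg μ (X.submatrix regroup regroup) =
      (twoFoldTwirl μ X).submatrix regroup regroup := by
  ext p q
  simp only [twirl4Avg, twoFoldTwirl, doubled2_eq_submatrix, Matrix.conjTranspose_submatrix,
    Matrix.submatrix_mul_equiv, Matrix.submatrix_apply, Matrix.of_apply]

lemma swapOp_eq_factorSwap : swapOp = factorSwap (Fin 2) := rfl

lemma swapOp_kronecker_swapOp :
    swapOp ⊗ₖ swapOp = (factorSwap (Fin 2 × Fin 2)).submatrix regroup regroup := by
  ext ⟨⟨a, b⟩, c, e⟩ ⟨⟨a', b'⟩, c', e'⟩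
  simp only [Matrix.kroneckerMap_apply, swapOp, factorSwap, Matrix.of_apply,
    Matrix.submatrix_apply, Equiv.prodProdProdComm_apply, Prod.mk.injEq, ite_and, mul_ite,
    mul_one, mul_zero]
  split_ifs <;> rfl

/-- The Haar twirl over `U(4)`, in qubit-wise order, of an operator with given traces
against the identity and the full swap. -/
lemma twirl4Avg_of_trace {μ : Measure U4} (hμ : IsHaarProb μ)
    {O : Matrix ((Fin 2 × Fin 2) × (Fin 2 × Fin 2)) ((Fin 2 × Fin 2) × (Fin 2 × Fin 2)) ℂ}
    (h₁ : O.trace = 1) (h₂ : (O * (swapOp ⊗ₖ swapOp)).trace = 1) :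
    twirl4Avg μ O = (20 : ℂ)⁻¹ • 1 + (20 : ℂ)⁻¹ • (swapOp ⊗ₖ swapOp) := by
  obtain ⟨X, rfl⟩ : ∃ X, O = Matrix.submatrix X regroup regroup :=
    ⟨O.submatrix regroup.symm regroup.symm, by ext; simp⟩
  have htr (Y : Matrix ((Fin 2 × Fin 2) × (Fin 2 × Fin 2)) ((Fin 2 × Fin 2) × (Fin 2 × Fin 2)) ℂ) :
      (Y.submatrix regroup regroup).trace = Y.trace :=
    Equiv.sum_comp regroup fun p => Y p p
  rw [swapOp_kronecker_swapOp, Matrix.submatrix_mul_equiv, htr] at h₂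
  rw [htr] at h₁
  obtain ⟨a, b, hab, ha, hb⟩ := twoFoldTwirl_eq_smul_one_add_smul_factorSwap hμ X
  rw [h₁] at ha
  rw [h₂] at hb
  simp only [Fintype.card_prod, Fintype.card_fin] at ha hb
  push_cast at ha hb
  obtain rfl : a = 20⁻¹ := by linear_combination ha / 15 - hb / 60
  obtain rfl : b = 20⁻¹ := by linear_combination hb / 15 - ha / 60
  rw [twirl4Avg_submatrix, hab, swapOp_kronecker_swapOp, Matrix.submatrix_add,
    Matrix.submatrix_smul, Matrix.submatrix_smul]
  simp

/-- The Haar average over `V ∈ U(4)` of the doubled action on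
`(I/4)⊗(𝒮/2)` (and on `(𝒮/2)⊗(I/4)`) equals
`(4/5)(I/4)⊗(I/4) + (1/5)(𝒮/2)⊗(𝒮/2)`, while `(I/4)⊗(I/4)` and `(𝒮/2)⊗(𝒮/2)` are fixed. -/
theorem u4_twirl_transfer
    (μ : Measure U4) (hμ : IsHaarProb μ) :
    twirl4Avg μ (O01 0 ⊗ₖ O01 1) =
        (4 / 5 : ℂ) • (O01 0 ⊗ₖ O01 0) + (1 / 5 : ℂ) • (O01 1 ⊗ₖ O01 1) ∧
      twirl4Avg μ (O01 1 ⊗ₖ O01 0) =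
        (4 / 5 : ℂ) • (O01 0 ⊗ₖ O01 0) + (1 / 5 : ℂ) • (O01 1 ⊗ₖ O01 1) ∧
      twirl4Avg μ (O01 0 ⊗ₖ O01 0) = O01 0 ⊗ₖ O01 0 ∧
      twirl4Avg μ (O01 1 ⊗ₖ O01 1) = O01 1 ⊗ₖ O01 1 := by
  have := hμ.1
  have h0 : O01 0 = (4 : ℂ)⁻¹ • 1 := rfl
  have h1 : O01 1 = (2 : ℂ)⁻¹ • swapOp := rfl
  have hS : swapOp.trace = 2 := by rw [swapOp_eq_factorSwap, trace_factorSwap]; simp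
  have hSS : swapOp * swapOp = 1 := factorSwap_mul_self
  have h00 : O01 0 ⊗ₖ O01 0 = (16 : ℂ)⁻¹ • 1 := by
    rw [h0, Matrix.smul_kronecker, Matrix.kronecker_smul, Matrix.one_kronecker_one, smul_smul]
    norm_num
  have h11 : O01 1 ⊗ₖ O01 1 = (4 : ℂ)⁻¹ • (swapOp ⊗ₖ swapOp) := by
    rw [h1, Matrix.smul_kronecker, Matrix.kronecker_smul, smul_smul]
    norm_num
  have hout : (4 / 5 : ℂ) • (O01 0 ⊗ₖ O01 0) + (1 / 5 : ℂ) • (O01 1 ⊗ₖ O01 1) =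
      (20 : ℂ)⁻¹ • 1 + (20 : ℂ)⁻¹ • (swapOp ⊗ₖ swapOp) := by
    rw [h00, h11, smul_smul, smul_smul]
    norm_num
  rw [hout]
  refine ⟨twirl4Avg_of_trace hμ ?_ ?_, twirl4Avg_of_trace hμ ?_ ?_, ?_, ?_⟩
  · rw [Matrix.trace_kronecker, h0, h1]
    simp [hS]
  · rw [← Matrix.mul_kronecker_mul, Matrix.trace_kronecker, h0, h1]
    simp [hS, hSS]
    norm_num
  · rw [Matrix.trace_kronecker, h0, h1]
    simp [hS]
  · rw [← Matrix.mul_kronecker_mul, Matrix.trace_kronecker, h0, h1]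
    simp [hS, hSS]
    norm_num
  · have h : O01 0 ⊗ₖ O01 0 = ((16 : ℂ)⁻¹ • 1 : Matrix _ _ ℂ).submatrix regroup regroup := by
      rw [h00, Matrix.submatrix_smul]
      simp
    rw [h, twirl4Avg_submatrix, twoFoldTwirl_eq_self]
    exact fun V => (Commute.one_left _).smul_left _
  · have h : O01 1 ⊗ₖ O01 1 =
        ((4 : ℂ)⁻¹ • factorSwap (Fin 2 × Fin 2)).submatrix regroup regroup := by
      rw [h11, swapOp_kronecker_swapOp, Matrix.submatrix_smul]
      rfl
    rw [h, twirl4Avg_submatrix, twoFoldTwirl_eq_self]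
    exact fun V => (commute_factorSwap_kronecker_self V).smul_left _
end
end

section
/- Let 𝒩 be a single-qubit quantum channel and let δ, γ ∈ [0,1] be such that the twirled doubled action of 𝒩 satisfies ∫ (V⊗V)(𝒩⊗𝒩)(I/4)(V⊗V)† dV = (1−δ)(I/4) + δ(𝒮/2) and ∫ (V⊗V)(𝒩⊗𝒩)(𝒮/2)(V⊗V)† dV = γ(I/4) + (1−γ)(𝒮/2), with V Haar on U(2). On the doubled n-qubit space, let T be the map applying (𝒩⊗𝒩) followed by a single-qubit twirl to each of the n doubled factors. Then for every 0 ≤ S ≤ n, T(|S⟩) = Σ_{S'=0}^{n} N_{S',S} |S'⟩, where N_{S',S} = Σ_{a=max(0, S−S')}^{min(S, n−S')} C(S, a) C(n−S, S'−(S−a)) δ^{S'−(S−a)} γ^{a} (1−δ)^{n−S'−a} (1−γ)^{S−a}. -/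
open Matrix Kronecker MeasureTheory

noncomputable section

/-- Embed a single-site doubled operator `M` at site `i`, acting as the identity elsewhere. -/
def actAt {ι : Type*} [Fintype ι] [DecidableEq ι] (i : ι)
    (M : Matrix (Fin 2 × Fin 2) (Fin 2 × Fin 2) ℂ) :
    Matrix (ι → Fin 2 × Fin 2) (ι → Fin 2 × Fin 2) ℂ :=
  Matrix.of fun x y =>
    M (x i) (y i) * ∏ l ∈ Finset.univ.filter (· ≠ i), (if x l = y l then (1 : ℂ) else 0)

/-- The single-qubit Haar twirl `ℳᵢ` at site `i` (entrywise Bochner integral). -/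
noncomputable def twirlAt {ι : Type*} [Fintype ι] [DecidableEq ι]
    (μ : MeasureTheory.Measure U2) (i : ι)
    (O : Matrix (ι → Fin 2 × Fin 2) (ι → Fin 2 × Fin 2) ℂ) :
    Matrix (ι → Fin 2 × Fin 2) (ι → Fin 2 × Fin 2) ℂ :=
  Matrix.of fun x y =>
    ∫ V : U2,
      ((actAt i ((V : Matrix (Fin 2) (Fin 2) ℂ) ⊗ₖ (V : Matrix (Fin 2) (Fin 2) ℂ)) * O *
        (actAt i ((V : Matrix (Fin 2) (Fin 2) ℂ) ⊗ₖ (V : Matrix (Fin 2) (Fin 2) ℂ)))ᴴ) x y) ∂μ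

/-- Average over all permutations of the sites:
`(1/n!) ∑_{P ∈ S_n} P(O)`, where `P` permutes the tensor factors. -/
noncomputable def permAvg {ι : Type*} [Fintype ι] [DecidableEq ι]
    (O : Matrix (ι → Fin 2 × Fin 2) (ι → Fin 2 × Fin 2) ℂ) :
    Matrix (ι → Fin 2 × Fin 2) (ι → Fin 2 × Fin 2) ℂ :=
  (((Fintype.card ι).factorial : ℂ))⁻¹ •
    ∑ P : Equiv.Perm ι, Matrix.of fun x y => O (x ∘ P) (y ∘ P)

/-- The doubled channel `𝒩 ⊗ 𝒩` on one doubled qubit, for `𝒩` with Kraus operators `K`. -/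
def doubledChannel {s : ℕ} (K : Fin s → Matrix (Fin 2) (Fin 2) ℂ)
    (M : Matrix (Fin 2 × Fin 2) (Fin 2 × Fin 2) ℂ) :
    Matrix (Fin 2 × Fin 2) (Fin 2 × Fin 2) ℂ :=
  ∑ j : Fin s, ∑ l : Fin s, (K j ⊗ₖ K l) * M * (K j ⊗ₖ K l)ᴴ

/-- `𝒩 ⊗ 𝒩` applied at site `i` of the doubled `n`-site space. -/
def doubledChannelAt {ι : Type*} [Fintype ι] [DecidableEq ι] {s : ℕ}
    (K : Fin s → Matrix (Fin 2) (Fin 2) ℂ) (i : ι)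
    (O : Matrix (ι → Fin 2 × Fin 2) (ι → Fin 2 × Fin 2) ℂ) :
    Matrix (ι → Fin 2 × Fin 2) (ι → Fin 2 × Fin 2) ℂ :=
  ∑ j : Fin s, ∑ l : Fin s,
    actAt i (K j ⊗ₖ K l) * O * (actAt i (K j ⊗ₖ K l))ᴴ

/-- Apply `𝒩 ⊗ 𝒩` followed by a single-qubit twirl to each of the `n` doubled sites. -/
noncomputable def noiseLayer {n : ℕ} {s : ℕ} (μ : Measure U2)
    (K : Fin s → Matrix (Fin 2) (Fin 2) ℂ)
    (O : Matrix (Fin n → Fin 2 × Fin 2) (Fin n → Fin 2 × Fin 2) ℂ) :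
    Matrix (Fin n → Fin 2 × Fin 2) (Fin n → Fin 2 × Fin 2) ℂ :=
  (List.finRange n).foldl (fun O i => twirlAt μ i (doubledChannelAt K i O)) O

/-- The noise transfer-matrix entry
`N_{S',S} = ∑_{a=max(0,S−S')}^{min(S,n−S')} C(S,a) C(n−S, S'−(S−a))
  δ^{S'−(S−a)} γ^a (1−δ)^{n−S'−a} (1−γ)^{S−a}`. -/
noncomputable def Ntransfer (n S' S : ℕ) (δ γ : ℝ) : ℂ :=
  ∑ a ∈ Finset.Icc (S - S') (min S (n - S')),
    (S.choose a : ℂ) * ((n - S).choose (S' - (S - a)) : ℂ) *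
      ((δ : ℂ) ^ (S' - (S - a))) * ((γ : ℂ) ^ a) *
      (((1 - δ : ℝ) : ℂ) ^ (n - S' - a)) * (((1 - γ : ℝ) : ℂ) ^ (S - a))

section TensorSites

variable {ι : Type*} [Fintype ι]

lemma tensorSites_mul [DecidableEq ι] (f g : ι → Matrix (Fin 2 × Fin 2) (Fin 2 × Fin 2) ℂ) :
    tensorSites f * tensorSites g = tensorSites fun i => f i * g i := by
  ext x y
  simp only [tensorSites, Matrix.mul_apply, Matrix.of_apply]
  rw [Finset.prod_univ_sum, Fintype.piFinset_univ]
  exact Finset.sum_congr rfl fun z _ => Finset.prod_mul_distrib.symm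

lemma tensorSites_conjTranspose (f : ι → Matrix (Fin 2 × Fin 2) (Fin 2 × Fin 2) ℂ) :
    (tensorSites f)ᴴ = tensorSites fun i => (f i)ᴴ := by
  ext x y
  simp [tensorSites, Matrix.conjTranspose_apply]

variable [DecidableEq ι]

lemma tensorSites_update_apply (f : ι → Matrix (Fin 2 × Fin 2) (Fin 2 × Fin 2) ℂ) (i : ι)
    (A : Matrix (Fin 2 × Fin 2) (Fin 2 × Fin 2) ℂ) (x y : ι → Fin 2 × Fin 2) :
    tensorSites (Function.update f i A) x y =
      A (x i) (y i) * ∏ l ∈ Finset.univ.filter (· ≠ i), f l (x l) (y l) := by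
  simp only [tensorSites, Matrix.of_apply]
  rw [← Finset.mul_prod_erase _ _ (Finset.mem_univ i), Function.update_self,
    ← Finset.filter_ne' Finset.univ i]
  congr 1
  refine Finset.prod_congr rfl fun l hl => ?_
  rw [Function.update_of_ne (Finset.mem_filter.mp hl).2]

lemma actAt_eq_tensorSites (i : ι) (M : Matrix (Fin 2 × Fin 2) (Fin 2 × Fin 2) ℂ) :
    actAt i M = tensorSites (Function.update (fun _ => 1) i M) := by
  ext x y
  rw [tensorSites_update_apply]
  simp [actAt, Matrix.one_apply]

lemma actAt_conj_tensorSites (i : ι) (M : Matrix (Fin 2 × Fin 2) (Fin 2 × Fin 2) ℂ)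
    (f : ι → Matrix (Fin 2 × Fin 2) (Fin 2 × Fin 2) ℂ) :
    actAt i M * tensorSites f * (actAt i M)ᴴ =
      tensorSites (Function.update f i (M * f i * Mᴴ)) := by
  rw [actAt_eq_tensorSites, tensorSites_conjTranspose, tensorSites_mul, tensorSites_mul]
  congr 1
  funext l
  by_cases h : l = i
  · subst h; simp
  · simp [Function.update_of_ne h]

lemma doubledChannelAt_tensorSites {s : ℕ} (K : Fin s → Matrix (Fin 2) (Fin 2) ℂ) (i : ι)
    (f : ι → Matrix (Fin 2 × Fin 2) (Fin 2 × Fin 2) ℂ) :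
    doubledChannelAt K i (tensorSites f) =
      tensorSites (Function.update f i (doubledChannel K (f i))) := by
  ext x y
  simp only [doubledChannelAt, actAt_conj_tensorSites, doubledChannel, Matrix.sum_apply,
    tensorSites_update_apply, Finset.sum_mul]

lemma doubledChannelAt_sum {α : Type*} {s : ℕ} (K : Fin s → Matrix (Fin 2) (Fin 2) ℂ) (i : ι)
    (t : Finset α) (c : α → ℂ)
    (O : α → Matrix (ι → Fin 2 × Fin 2) (ι → Fin 2 × Fin 2) ℂ) :
    doubledChannelAt K i (∑ k ∈ t, c k • O k) = ∑ k ∈ t, c k • doubledChannelAt K i (O k) := by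
  simp only [doubledChannelAt, Matrix.mul_sum, Matrix.sum_mul, Finset.smul_sum,
    Matrix.mul_smul, Matrix.smul_mul]
  refine (Finset.sum_congr rfl fun j _ => Finset.sum_comm).trans Finset.sum_comm

/-- The tensor product is multilinear: expand every site in a common finite family. -/
lemma tensorSites_sum_smul {β : Type*} [Fintype β] (m : ι → β → ℂ)
    (A : β → Matrix (Fin 2 × Fin 2) (Fin 2 × Fin 2) ℂ) :
    tensorSites (fun i => ∑ b, m i b • A b) =
      ∑ τ : ι → β, (∏ i, m i (τ i)) • tensorSites fun i => A (τ i) := by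
  ext x y
  simp only [tensorSites, Matrix.of_apply, Matrix.sum_apply, Matrix.smul_apply, smul_eq_mul]
  classical
  rw [Finset.prod_univ_sum, Fintype.piFinset_univ]
  exact Finset.sum_congr rfl fun z _ => Finset.prod_mul_distrib

end TensorSites

section Twirl

lemma measurable_U2_entry (a b : Fin 2) :
    Measurable fun V : U2 => (V : Matrix (Fin 2) (Fin 2) ℂ) a b :=
  ((measurable_pi_apply b).comp (measurable_pi_apply (X := fun _ : Fin 2 => Fin 2 → ℂ) a)).comp
    measurable_subtype_coe

lemma integrable_twirl_entry (μ : Measure U2) [IsFiniteMeasure μ]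
    (O : Matrix (Fin 2 × Fin 2) (Fin 2 × Fin 2) ℂ) (p q : Fin 2 × Fin 2) :
    Integrable (fun V : U2 =>
      (((V : Matrix (Fin 2) (Fin 2) ℂ) ⊗ₖ (V : Matrix (Fin 2) (Fin 2) ℂ)) * O *
        (((V : Matrix (Fin 2) (Fin 2) ℂ) ⊗ₖ (V : Matrix (Fin 2) (Fin 2) ℂ))ᴴ)) p q) μ := by
  simp only [Matrix.mul_apply, Finset.sum_mul, Matrix.conjTranspose_apply,
    Matrix.kroneckerMap_apply]
  refine integrable_finsetSum _ fun r _ => integrable_finsetSum _ fun t _ => ?_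
  have hm := measurable_U2_entry
  have hb (V : U2) (a b : Fin 2) : ‖(V : Matrix (Fin 2) (Fin 2) ℂ) a b‖ ≤ 1 :=
    entry_norm_bound_of_unitary V.2 a b
  refine Integrable.of_bound (C := ‖O t r‖) (Measurable.aestronglyMeasurable ?_) (.of_forall ?_)
  · exact ((((hm _ _).mul (hm _ _)).mul_const _).mul
      (continuous_star.measurable.comp ((hm _ _).mul (hm _ _))))
  · intro V
    have h2 (a b c d : Fin 2) : ‖(V : Matrix (Fin 2) (Fin 2) ℂ) a b *
        (V : Matrix (Fin 2) (Fin 2) ℂ) c d‖ ≤ 1 := by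
      rw [norm_mul]
      exact mul_le_one₀ (hb V _ _) (norm_nonneg _) (hb V _ _)
    rw [norm_mul, norm_mul, norm_star]
    calc _ ≤ 1 * ‖O t r‖ * 1 := by gcongr <;> exact h2 _ _ _ _
      _ = ‖O t r‖ := by ring

variable {ι : Type*} [Fintype ι] [DecidableEq ι]

lemma twirlAt_sum_tensorSites {α : Type*} (μ : Measure U2) [IsFiniteMeasure μ] (i : ι)
    (t : Finset α) (c : α → ℂ)
    (f : α → ι → Matrix (Fin 2 × Fin 2) (Fin 2 × Fin 2) ℂ) :
    twirlAt μ i (∑ k ∈ t, c k • tensorSites (f k)) =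
      ∑ k ∈ t, c k • tensorSites (Function.update (f k) i (twirlAvg μ (f k i))) := by
  ext x y
  simp only [twirlAt, Matrix.of_apply, Matrix.mul_sum, Matrix.sum_mul, Matrix.mul_smul,
    Matrix.smul_mul, actAt_conj_tensorSites, Matrix.sum_apply, Matrix.smul_apply, smul_eq_mul,
    tensorSites_update_apply]
  rw [integral_finsetSum _ fun k _ =>
    ((integrable_twirl_entry μ (f k i) (x i) (y i)).mul_const _).const_mul _]
  refine Finset.sum_congr rfl fun k _ => ?_
  rw [integral_const_mul, integral_mul_const]
  rfl

lemma foldl_sites_sum_tensorSites {α : Type*} {s : ℕ} (μ : Measure U2) [IsFiniteMeasure μ]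
    (K : Fin s → Matrix (Fin 2) (Fin 2) ℂ) (t : Finset α) (c : α → ℂ) (L : List ι)
    (hL : L.Nodup) (f : α → ι → Matrix (Fin 2 × Fin 2) (Fin 2 × Fin 2) ℂ) :
    L.foldl (fun O i => twirlAt μ i (doubledChannelAt K i O)) (∑ k ∈ t, c k • tensorSites (f k)) =
      ∑ k ∈ t, c k • tensorSites fun i =>
        if i ∈ L then twirlAvg μ (doubledChannel K (f k i)) else f k i := by
  induction L generalizing f with
  | nil => simp
  | cons i L ih =>
    obtain ⟨hi, hL⟩ := List.nodup_cons.mp hL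
    rw [List.foldl_cons, doubledChannelAt_sum]
    simp only [doubledChannelAt_tensorSites]
    rw [twirlAt_sum_tensorSites, ih hL]
    refine Finset.sum_congr rfl fun k _ => ?_
    congr 2
    funext l
    by_cases h : l = i
    · subst h; simp [hi]
    · simp [h]

end Twirl

section Counting

open Polynomial

lemma coeff_C_add_C_mul_X_pow (a b : ℂ) (m k : ℕ) :
    ((C a + C b * X) ^ m : ℂ[X]).coeff k = (m.choose k : ℂ) * b ^ k * a ^ (m - k) := by
  rw [add_comm, add_pow, finsetSum_coeff]
  have h (j : ℕ) : ((C b * X) ^ j * C a ^ (m - j) * ((m.choose j : ℕ) : ℂ[X])).coeff k =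
      if k = j then (m.choose j : ℂ) * b ^ j * a ^ (m - j) else 0 := by
    rw [mul_pow, ← C_pow, ← C_pow, ← C_eq_natCast,
      show C (b ^ j) * X ^ j * C (a ^ (m - j)) * C (m.choose j : ℂ) =
        C ((m.choose j : ℂ) * b ^ j * a ^ (m - j)) * X ^ j by simp only [C_mul]; ring,
      coeff_C_mul, coeff_X_pow]
    simp
  simp only [h, Finset.sum_ite_eq, Finset.mem_range]
  split_ifs with hk
  · rfl
  · rw [Nat.choose_eq_zero_of_lt (by omega)]; simp

/-- Summing a product weight over all binary strings of weight `S`, against a fixed string. -/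
lemma sum_prod_weight_eq {ι : Type*} [Fintype ι] [DecidableEq ι] (m : Fin 2 → Fin 2 → ℂ)
    (τ : ι → Fin 2) (S : ℕ) :
    ∑ σ ∈ Finset.univ.filter
        (fun σ : ι → Fin 2 => (Finset.univ.filter fun i => σ i = 1).card = S),
      ∏ i, m (τ i) (σ i) =
    ∑ a ∈ Finset.range (S + 1),
      (((Fintype.card ι - (Finset.univ.filter fun i => τ i = 1).card).choose a : ℂ) *
          m 0 1 ^ a * m 0 0 ^ (Fintype.card ι - (Finset.univ.filter fun i => τ i = 1).card - a)) *
        (((Finset.univ.filter fun i => τ i = 1).card.choose (S - a) : ℂ) * m 1 1 ^ (S - a) *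
          m 1 0 ^ ((Finset.univ.filter fun i => τ i = 1).card - (S - a))) := by
  set k := (Finset.univ.filter fun i => τ i = 1).card with hk
  have hk0 : (Finset.univ.filter fun i => ¬ τ i = 1).card = Fintype.card ι - k := by
    rw [← Finset.compl_filter, Finset.card_compl]
  have hprod : ∏ i, ∑ b : Fin 2, (C (m (τ i) b) * X ^ (b : ℕ) : ℂ[X]) =
      (C (m 0 0) + C (m 0 1) * X) ^ (Fintype.card ι - k) *
        (C (m 1 0) + C (m 1 1) * X) ^ k := by
    rw [← Finset.prod_filter_mul_prod_filter_not Finset.univ (fun i => τ i = 1), mul_comm,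
      ← hk0, hk, ← Finset.prod_const, ← Finset.prod_const]
    congr 1 <;> refine Finset.prod_congr rfl fun i hi => ?_
    · have : τ i = 0 := by have := (Finset.mem_filter.mp hi).2; omega
      simp [this]
    · simp [(Finset.mem_filter.mp hi).2]
  have hexp : ∏ i, ∑ b : Fin 2, (C (m (τ i) b) * X ^ (b : ℕ) : ℂ[X]) =
      ∑ σ : ι → Fin 2, C (∏ i, m (τ i) (σ i)) *
        X ^ (Finset.univ.filter fun i => σ i = 1).card := by
    rw [Finset.prod_univ_sum, Fintype.piFinset_univ]
    refine Finset.sum_congr rfl fun σ _ => ?_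
    rw [Finset.prod_mul_distrib, Finset.prod_pow_eq_pow_sum, map_prod, Finset.card_filter]
    congr 2
    refine Finset.sum_congr rfl fun i _ => ?_
    generalize σ i = b
    fin_cases b <;> rfl
  have h := congrArg (fun p : ℂ[X] => p.coeff S) (hexp.symm.trans hprod)
  simp only [finsetSum_coeff, coeff_C_mul, coeff_X_pow] at h
  simp only [coeff_mul, coeff_C_add_C_mul_X_pow] at h
  rw [Finset.Nat.sum_antidiagonal_eq_sum_range_succ_mk] at h
  rw [← h, Finset.sum_filter]
  refine Finset.sum_congr rfl fun σ _ => ?_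
  simp [eq_comm]

lemma choose_mul_choose_mul_choose_exchange (a b c d : ℕ) :
    (a + b + c + d).choose (b + c) * (a + d).choose a * (b + c).choose b =
      (a + b + c + d).choose (a + b) * (a + b).choose a * (c + d).choose c := by
  have h1 := Nat.add_choose_mul_factorial_mul_factorial (a + d) (b + c)
  have h2 := Nat.add_choose_mul_factorial_mul_factorial d a
  have h3 := Nat.add_choose_mul_factorial_mul_factorial c b
  have h4 := Nat.add_choose_mul_factorial_mul_factorial (c + d) (a + b)
  have h5 := Nat.add_choose_mul_factorial_mul_factorial b a
  have h6 := Nat.add_choose_mul_factorial_mul_factorial d c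
  rw [add_comm d a] at h2
  rw [add_comm c b] at h3
  rw [add_comm b a] at h5
  rw [add_comm d c] at h6
  rw [show a + d + (b + c) = a + b + c + d by ring, ← h2, ← h3] at h1
  rw [show c + d + (a + b) = a + b + c + d by ring, ← h5, ← h6] at h4
  have hpos : 0 < a.factorial * b.factorial * c.factorial * d.factorial := by positivity
  refine Nat.eq_of_mul_eq_mul_right hpos ?_
  linarith

lemma Ntransfer_mul_choose (n S' S : ℕ) (hS : S ≤ n) (hS' : S' ≤ n) (δ γ : ℝ) :
    (n.choose S : ℂ) * Ntransfer n S' S δ γ =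
      (n.choose S' : ℂ) * ∑ a ∈ Finset.range (S + 1),
        (((n - S').choose a : ℂ) * (γ : ℂ) ^ a * ((1 - δ : ℝ) : ℂ) ^ (n - S' - a)) *
          ((S'.choose (S - a) : ℂ) * ((1 - γ : ℝ) : ℂ) ^ (S - a) *
            (δ : ℂ) ^ (S' - (S - a))) := by
  have hsub : Finset.Icc (S - S') (min S (n - S')) ⊆ Finset.range (S + 1) := by
    intro a ha
    simp only [Finset.mem_Icc, Finset.mem_range, le_min_iff] at ha ⊢
    omega
  rw [← Finset.sum_subset hsub, Ntransfer, Finset.mul_sum, Finset.mul_sum]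
  · refine Finset.sum_congr rfl fun a ha => ?_
    simp only [Finset.mem_Icc, le_min_iff] at ha
    have h := choose_mul_choose_mul_choose_exchange a (S - a) (S' - (S - a)) (n - S' - a)
    rw [show a + (S - a) + (S' - (S - a)) + (n - S' - a) = n by omega,
      show S - a + (S' - (S - a)) = S' by omega, show a + (n - S' - a) = n - S' by omega,
      show a + (S - a) = S by omega, show S' - (S - a) + (n - S' - a) = n - S by omega] at h
    have h' : (n.choose S' : ℂ) * ((n - S').choose a : ℂ) * (S'.choose (S - a) : ℂ) =
        (n.choose S : ℂ) * (S.choose a : ℂ) * ((n - S).choose (S' - (S - a)) : ℂ) := by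
      exact_mod_cast h
    linear_combination -(γ : ℂ) ^ a * ((1 - δ : ℝ) : ℂ) ^ (n - S' - a) *
      ((1 - γ : ℝ) : ℂ) ^ (S - a) * (δ : ℂ) ^ (S' - (S - a)) * h'
  · intro a ha hna
    simp only [Finset.mem_Icc, Finset.mem_range, le_min_iff] at ha hna
    by_cases h : n - S' < a
    · simp [Nat.choose_eq_zero_of_lt h]
    · simp [Nat.choose_eq_zero_of_lt (show S' < S - a by omega)]

end Counting

/-- If the twirled doubled action of a single-qubit channel `𝒩` sends
`I/4 ↦ (1−δ)(I/4) + δ(𝒮/2)` and `𝒮/2 ↦ γ(I/4) + (1−γ)(𝒮/2)`, then applying `𝒩 ⊗ 𝒩`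
followed by a single-qubit twirl at every one of the `n` sites acts on the symmetrized basis
as `T(|S⟩) = ∑_{S'} N_{S',S} |S'⟩`. -/
theorem noise_layer_transfer_matrix
    (n : ℕ) (μ : Measure U2) (hμ : IsHaarProb μ)
    (s : ℕ) (K : Fin s → Matrix (Fin 2) (Fin 2) ℂ)
    (hK : (∑ j, (K j)ᴴ * K j) = 1)
    (δ γ : ℝ) (hδ0 : 0 ≤ δ) (hδ1 : δ ≤ 1) (hγ0 : 0 ≤ γ) (hγ1 : γ ≤ 1)
    (hδeq : twirlAvg μ (doubledChannel K (O01 0)) =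
      ((1 - δ : ℝ) : ℂ) • O01 0 + (δ : ℂ) • O01 1)
    (hγeq : twirlAvg μ (doubledChannel K (O01 1)) =
      (γ : ℂ) • O01 0 + ((1 - γ : ℝ) : ℂ) • O01 1)
    (S : ℕ) (hS : S ≤ n) :
    noiseLayer (n := n) μ K (basisS (ι := Fin n) S) =
      ∑ S' ∈ Finset.range (n + 1), Ntransfer n S' S δ γ • basisS (ι := Fin n) S' := by
  have := hμ.1
  let m : Fin 2 → Fin 2 → ℂ :=
    !![((1 - δ : ℝ) : ℂ), (γ : ℂ); (δ : ℂ), ((1 - γ : ℝ) : ℂ)]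
  have hΦ (b : Fin 2) : twirlAvg μ (doubledChannel K (O01 b)) = ∑ c, m c b • O01 c := by
    fin_cases b
    · simpa [m] using hδeq
    · simpa [m] using hγeq
  have hcard (τ : Fin n → Fin 2) : (Finset.univ.filter fun i => τ i = 1).card ≤ n := by
    simpa using Finset.card_le_univ (Finset.univ.filter fun i => τ i = 1)
  rw [noiseLayer, basisS, Finset.smul_sum,
    foldl_sites_sum_tensorSites μ K _ _ _ (List.nodup_finRange n)]
  simp only [List.mem_finRange, if_true, hΦ, basisS, Fintype.card_fin]
  simp only [tensorSites_sum_smul (fun i b => m b _)]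
  rw [← Finset.smul_sum, Finset.sum_comm, ← Finset.sum_fiberwise_of_maps_to
    (g := fun τ : Fin n → Fin 2 => (Finset.univ.filter fun i => τ i = 1).card)
    (t := Finset.range (n + 1)) (fun τ _ => Finset.mem_range_succ_iff.mpr (hcard τ)),
    Finset.smul_sum]
  refine Finset.sum_congr rfl fun S' hS' => ?_
  have hS'n := Finset.mem_range_succ_iff.mp hS'
  simp only [Finset.smul_sum, smul_smul]
  refine Finset.sum_congr rfl fun τ hτ => ?_
  rw [← Finset.sum_smul, ← Finset.mul_sum, sum_prod_weight_eq,
    (Finset.mem_filter.mp hτ).2, Fintype.card_fin]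
  congr 1
  have hN := Ntransfer_mul_choose n S' S hS hS'n δ γ
  have h0 : (n.choose S : ℂ) ≠ 0 := by exact_mod_cast (Nat.choose_pos hS).ne'
  have h0' : (n.choose S' : ℂ) ≠ 0 := by exact_mod_cast (Nat.choose_pos hS'n).ne'
  rw [← div_eq_mul_inv, inv_mul_eq_div, div_eq_div_iff h0 h0', mul_comm _ (n.choose S : ℂ), hN,
    mul_comm]
  rfl
end
end
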